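/- arXiv:2209.12098 — 2 statements merged into one kernel-verified Lean document; each statement's English description precedes it below -/
import Mathlib

section
/- There exists a constant c' > 0 such that for every θ ∈ (0, π/4) and every natural number N ≥ 1, the optimal directional discrepancy satisfies D(N, R_{[-θ,θ]}) ≥ c'·θ·N^{1/5}. -/
open Real MeasureTheory Set

noncomputable section

/-- Rotation of the plane by angle `ω` about the origin. -/
def rot (ω : ℝ) (p : ℝ × ℝ) : ℝ × ℝ :=
  (p.1 * Real.cos ω - p.2 * Real.sin ω, p.1 * Real.sin ω + p.2 * Real.cos ω)

/-- The unit square `[0,1]²`. -/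
def unitSq : Set (ℝ × ℝ) := Set.Icc (0:ℝ) 1 ×ˢ Set.Icc (0:ℝ) 1

/-- `R` is a closed rectangle having a side making angle `ω` with the x-axis
for some `ω ∈ Ω`. -/
def IsRectIn (Ω : Set ℝ) (R : Set (ℝ × ℝ)) : Prop :=
  ∃ ω ∈ Ω, ∃ a b c d : ℝ, a ≤ b ∧ c ≤ d ∧
    R = rot ω '' (Set.Icc a b ×ˢ Set.Icc c d)

/-- Local discrepancy of the `N`-point set `P` with respect to the set `R`:
`| |P ∩ R| − N · vol(R ∩ [0,1]²) |`. -/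
def localDisc (N : ℕ) (P : Finset (ℝ × ℝ)) (R : Set (ℝ × ℝ)) : ℝ :=
  |(((P : Set (ℝ × ℝ)) ∩ R).ncard : ℝ) - (N : ℝ) * (volume (R ∩ unitSq)).toReal|

/-- Directional discrepancy `D(P, R_Ω)` of a point set `P`. -/
def disc (N : ℕ) (P : Finset (ℝ × ℝ)) (Ω : Set ℝ) : ℝ :=
  sSup {d : ℝ | ∃ R : Set (ℝ × ℝ), IsRectIn Ω R ∧ d = localDisc N P R}

/-- Optimal directional discrepancy `D(N, R_Ω)`. -/
def optDisc (N : ℕ) (Ω : Set ℝ) : ℝ :=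
  sInf {d : ℝ | ∃ P : Finset (ℝ × ℝ), ↑P ⊆ unitSq ∧ P.card = N ∧ d = disc N P Ω}

open Complex in
lemma gauss_cis (b : ℝ) (hb : 0 < b) (t : ℝ) :
    (∫ s : ℝ, Real.exp (-b * s ^ 2) * Real.cos (s * t)) = √(π / b) * Real.exp (-t ^ 2 / (4 * b)) ∧
    (∫ s : ℝ, Real.exp (-b * s ^ 2) * Real.sin (s * t)) = 0 := by
  have h := fourierIntegral_gaussian (b := (b:ℂ)) (by simpa using hb) (t : ℂ)
  have e : ∀ s : ℝ, cexp (I * t * s) * cexp (-b * s ^ 2) =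
      (((Real.exp (-b * s ^ 2) * Real.cos (s * t) : ℝ) : ℂ) +
      ((Real.exp (-b * s ^ 2) * Real.sin (s * t) : ℝ) : ℂ) * I) := by
    intro s
    have : I * t * s = ((s * t : ℝ) : ℂ) * I := by push_cast; ring
    rw [this, Complex.exp_mul_I]
    push_cast; ring
  have i0 := integrable_exp_neg_mul_sq hb
  have ic : Integrable (fun s : ℝ => Real.exp (-b * s ^ 2) * Real.cos (s * t)) :=
    i0.mul_bdd (c := 1) (by fun_prop) (by filter_upwards with s; simpa using Real.abs_cos_le_one _)
  have is : Integrable (fun s : ℝ => Real.exp (-b * s ^ 2) * Real.sin (s * t)) :=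
    i0.mul_bdd (c := 1) (by fun_prop) (by filter_upwards with s; simpa using Real.abs_sin_le_one _)
  simp_rw [e] at h
  have ic' : Integrable (fun s : ℝ => ((Real.exp (-b * s ^ 2) * Real.cos (s * t) : ℝ) : ℂ)) := ic.ofReal
  have is' : Integrable (fun s : ℝ => ((Real.exp (-b * s ^ 2) * Real.sin (s * t) : ℝ) : ℂ) * I) :=
    Integrable.mul_const (f := fun s : ℝ => ((Real.exp (-b * s ^ 2) * Real.sin (s * t) : ℝ) : ℂ)) is.ofReal I
  rw [integral_add ic' is', integral_mul_const, integral_complex_ofReal,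
    integral_complex_ofReal] at h
  have r : ((π:ℂ) / b) ^ (1 / 2 : ℂ) * cexp (-(t:ℂ) ^ 2 / (4 * b)) =
      ((√(π / b) * Real.exp (-t ^ 2 / (4 * b)) : ℝ) : ℂ) := by
    rw [Real.sqrt_eq_rpow]
    push_cast
    rw [Complex.ofReal_cpow (by positivity)]
    push_cast; rfl
  rw [r] at h
  constructor
  · have h' := congrArg Complex.re h
    simpa only [Complex.add_re, Complex.add_im, Complex.mul_re, Complex.mul_im, Complex.ofReal_re, Complex.ofReal_im, Complex.I_re, Complex.I_im, mul_zero, mul_one, zero_mul, sub_zero, add_zero, zero_add] using h'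
  · have h' := congrArg Complex.im h
    simpa only [Complex.add_re, Complex.add_im, Complex.mul_re, Complex.mul_im, Complex.ofReal_re, Complex.ofReal_im, Complex.I_re, Complex.I_im, mul_zero, mul_one, zero_mul, sub_zero, add_zero, zero_add] using h'

lemma gint (b : ℝ) (hb : 0 < b) : Integrable (fun s : ℝ => Real.exp (-b * s ^ 2)) :=
  integrable_exp_neg_mul_sq hb

/-- sheared Gaussian weight -/
def gw (b d τ : ℝ) (ξ : ℝ × ℝ) : ℝ := Real.exp (-b * ξ.1 ^ 2) * Real.exp (-d * (ξ.2 - τ * ξ.1) ^ 2)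

lemma gw_cont (b d τ : ℝ) : Continuous (gw b d τ) := by unfold gw; fun_prop

lemma gw_int (b d τ : ℝ) (hb : 0 < b) (hd : 0 < d) : Integrable (gw b d τ) := by
  rw [Measure.volume_eq_prod, integrable_prod_iff (gw_cont b d τ).aestronglyMeasurable]
  constructor
  · filter_upwards with x
    exact ((gint d hd).comp_sub_right (τ * x)).const_mul (Real.exp (-b * x ^ 2))
  · have : ∀ x : ℝ, ∫ y : ℝ, ‖gw b d τ (x, y)‖ = Real.exp (-b * x ^ 2) * ∫ y : ℝ, Real.exp (-d * y ^ 2) := by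
      intro x
      have h2 : ∀ y, ‖gw b d τ (x, y)‖ = Real.exp (-b * x ^ 2) * Real.exp (-d * (y - τ * x) ^ 2) := by
        intro y; rw [Real.norm_of_nonneg (by unfold gw; positivity)]; rfl
      simp_rw [h2]
      rw [integral_const_mul]
      congr 1
      exact integral_sub_right_eq_self (fun y : ℝ => Real.exp (-d * y ^ 2)) (τ * x)
    simp_rw [this]
    exact (gint b hb).mul_const _

lemma gw_cos (b d τ : ℝ) (hb : 0 < b) (hd : 0 < d) (z : ℝ × ℝ) :
    ∫ ξ : ℝ × ℝ, gw b d τ ξ * Real.cos (ξ.1 * z.1 + ξ.2 * z.2) =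
      √(π / b) * √(π / d) * (Real.exp (-(z.1 + τ * z.2) ^ 2 / (4 * b)) * Real.exp (-z.2 ^ 2 / (4 * d))) := by
  have hi : Integrable (fun ξ : ℝ × ℝ => gw b d τ ξ * Real.cos (ξ.1 * z.1 + ξ.2 * z.2)) :=
    (gw_int b d τ hb hd).mul_bdd (c := 1) (by fun_prop)
      (by filter_upwards with s; simpa using Real.abs_cos_le_one _)
  rw [Measure.volume_eq_prod] at hi ⊢
  rw [integral_prod _ hi]
  have ic : Integrable (fun s : ℝ => Real.exp (-d * s ^ 2) * Real.cos (s * z.2)) :=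
    (gint d hd).mul_bdd (c := 1) (by fun_prop) (by filter_upwards with s; simpa using Real.abs_cos_le_one _)
  have is : Integrable (fun s : ℝ => Real.exp (-d * s ^ 2) * Real.sin (s * z.2)) :=
    (gint d hd).mul_bdd (c := 1) (by fun_prop) (by filter_upwards with s; simpa using Real.abs_sin_le_one _)
  have inner : ∀ x : ℝ, ∫ y : ℝ, gw b d τ (x, y) * Real.cos (x * z.1 + y * z.2) =
      (Real.exp (-b * x ^ 2) * Real.cos (x * (z.1 + τ * z.2))) *
        (√(π / d) * Real.exp (-z.2 ^ 2 / (4 * d))) := by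
    intro x
    rw [← integral_add_right_eq_self _ (τ * x)]
    have h2 : ∀ y : ℝ, gw b d τ (x, y + τ * x) * Real.cos (x * z.1 + (y + τ * x) * z.2) =
       (Real.exp (-b * x ^ 2) * Real.cos (x * (z.1 + τ * z.2))) * (Real.exp (-d * y ^ 2) * Real.cos (y * z.2)) -
       (Real.exp (-b * x ^ 2) * Real.sin (x * (z.1 + τ * z.2))) * (Real.exp (-d * y ^ 2) * Real.sin (y * z.2)) := by
      intro y
      have : x * z.1 + (y + τ * x) * z.2 = x * (z.1 + τ * z.2) + y * z.2 := by ring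
      rw [this, Real.cos_add]
      simp only [gw, add_sub_cancel_right]
      ring
    simp_rw [h2]
    rw [integral_sub (ic.const_mul _) (is.const_mul _), integral_const_mul, integral_const_mul,
      (gauss_cis d hd z.2).1, (gauss_cis d hd z.2).2]
    ring
  simp_rw [inner]
  rw [integral_mul_const, (gauss_cis b hb _).1]
  ring

/-- The quadratic form identity. -/
lemma quad_form {X Ξ : Type*} [MeasurableSpace X] [MeasurableSpace Ξ] (ρ : Measure X)
    [IsFiniteMeasure ρ] (m : Measure Ξ) [SFinite m] (σ : X → ℝ) (hσ : Measurable σ) (C : ℝ)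
    (hC : ∀ x, |σ x| ≤ C) (u : Ξ → X → ℝ) (hu : Measurable (Function.uncurry u))
    (w : Ξ → ℝ) (hw : Integrable w m) :
    ∫ ξ, w ξ * ((∫ x, σ x * Real.cos (u ξ x) ∂ρ) ^ 2 + (∫ x, σ x * Real.sin (u ξ x) ∂ρ) ^ 2) ∂m =
      ∫ x, σ x * ∫ x', σ x' * (∫ ξ, w ξ * Real.cos (u ξ x - u ξ x') ∂m) ∂ρ ∂ρ := by
  have huξ : ∀ ξ, Measurable (u ξ) := fun ξ => hu.comp (measurable_prodMk_left)
  have hux : ∀ x, Measurable (fun ξ => u ξ x) := fun x => hu.comp (measurable_prodMk_right)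
  have iσ : Integrable σ ρ := (integrable_const C).mono' hσ.aestronglyMeasurable
    (by filter_upwards with x using hC x)
  have ic : ∀ ξ, Integrable (fun x => σ x * Real.cos (u ξ x)) ρ := fun ξ =>
    iσ.mul_bdd (c := 1) (((huξ ξ).cos).aestronglyMeasurable)
      (by filter_upwards with s; simpa using Real.abs_cos_le_one _)
  have is : ∀ ξ, Integrable (fun x => σ x * Real.sin (u ξ x)) ρ := fun ξ =>
    iσ.mul_bdd (c := 1) (((huξ ξ).sin).aestronglyMeasurable)
      (by filter_upwards with s; simpa using Real.abs_sin_le_one _)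
  have e1 : ∀ ξ, w ξ * ((∫ x, σ x * Real.cos (u ξ x) ∂ρ) ^ 2 + (∫ x, σ x * Real.sin (u ξ x) ∂ρ) ^ 2)
      = ∫ q : X × X, w ξ * ((σ q.1 * σ q.2) * Real.cos (u ξ q.1 - u ξ q.2)) ∂(ρ.prod ρ) := by
    intro ξ
    rw [integral_const_mul, sq, sq, ← integral_prod_mul, ← integral_prod_mul,
      ← integral_add ((ic ξ).mul_prod (ic ξ)) ((is ξ).mul_prod (is ξ))]
    congr 1
    apply integral_congr_ae
    filter_upwards with q
    rw [Real.cos_sub]; ring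
  simp_rw [e1]
  have iq : Integrable (fun q : X × X => σ q.1 * σ q.2) (ρ.prod ρ) := iσ.mul_prod iσ
  have big : Integrable (fun p : Ξ × (X × X) => w p.1 * (σ p.2.1 * σ p.2.2) *
      Real.cos (u p.1 p.2.1 - u p.1 p.2.2)) (m.prod (ρ.prod ρ)) := by
    refine (hw.mul_prod iq).mul_bdd (c := 1) ?_
      (by filter_upwards with s; simpa using Real.abs_cos_le_one _)
    have h1 : Measurable (fun p : Ξ × (X × X) => u p.1 p.2.1) :=
      hu.comp (measurable_fst.prodMk (measurable_fst.comp measurable_snd))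
    have h2 : Measurable (fun p : Ξ × (X × X) => u p.1 p.2.2) :=
      hu.comp (measurable_fst.prodMk (measurable_snd.comp measurable_snd))
    exact (h1.sub h2).cos.aestronglyMeasurable
  have big' : Integrable (Function.uncurry fun (ξ : Ξ) (q : X × X) => w ξ * ((σ q.1 * σ q.2) * Real.cos (u ξ q.1 - u ξ q.2)))
      (m.prod (ρ.prod ρ)) := by
    refine big.congr ?_
    filter_upwards with p
    simp only [Function.uncurry]; ring
  rw [integral_integral_swap big']
  have e2 : ∀ q : X × X, ∫ ξ, w ξ * ((σ q.1 * σ q.2) * Real.cos (u ξ q.1 - u ξ q.2)) ∂m =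
      σ q.1 * (σ q.2 * ∫ ξ, w ξ * Real.cos (u ξ q.1 - u ξ q.2) ∂m) := by
    intro q
    rw [← integral_const_mul, ← integral_const_mul]
    congr 1; ext ξ; ring
  have i2 := big'.integral_prod_right
  simp only [Function.uncurry] at i2
  simp_rw [e2] at i2 ⊢
  rw [integral_prod _ i2]
  simp_rw [integral_const_mul]

open Classical in
/-- sign: `+1` on the points, `-1` off the points -/
def sg (P : Finset (ℝ × ℝ)) (x : ℝ × ℝ) : ℝ := if x ∈ P then 1 else -1

/-- total variation of the discrepancy measure -/
def rho (N : ℕ) (P : Finset (ℝ × ℝ)) : Measure (ℝ × ℝ) :=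
  (∑ p ∈ P, Measure.dirac p) + (N : ENNReal) • (volume.restrict unitSq)

lemma sg_meas (P : Finset (ℝ × ℝ)) : Measurable (sg P) := by
  unfold sg
  exact Measurable.ite P.finite_toSet.measurableSet measurable_const measurable_const

lemma sg_abs (P : Finset (ℝ × ℝ)) (x : ℝ × ℝ) : |sg P x| ≤ 1 := by
  unfold sg; split_ifs <;> simp

lemma unitSq_meas : MeasurableSet unitSq := measurableSet_Icc.prod measurableSet_Icc

lemma unitSq_vol : volume unitSq = 1 := by
  unfold unitSq
  rw [Measure.volume_eq_prod, Measure.prod_prod]; simp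

instance unitSq_fin : IsFiniteMeasure ((volume : Measure (ℝ × ℝ)).restrict unitSq) :=
  ⟨by simp [unitSq_vol]⟩

instance nu_fin (P : Finset (ℝ × ℝ)) : IsFiniteMeasure (∑ p ∈ P, Measure.dirac p) :=
  ⟨by simp⟩

instance lam_fin (N : ℕ) : IsFiniteMeasure ((N : ENNReal) • ((volume : Measure (ℝ × ℝ)).restrict unitSq)) :=
  ⟨by simp [unitSq_vol]⟩

instance rho_fin (N : ℕ) (P : Finset (ℝ × ℝ)) : IsFiniteMeasure (rho N P) := by
  unfold rho; infer_instance

lemma rho_univ (N : ℕ) (P : Finset (ℝ × ℝ)) (hP : P.card = N) : (rho N P).real univ = 2 * N := by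
  rw [Measure.real, rho]
  simp [unitSq_vol, hP]
  rw [ENNReal.toReal_add (by simp) (by simp)]
  simp; ring

lemma rho_ae (N : ℕ) (P : Finset (ℝ × ℝ)) (hP : ↑P ⊆ unitSq) : ∀ᵐ x ∂(rho N P), x ∈ unitSq := by
  rw [ae_iff]
  have hm : MeasurableSet {a | a ∉ unitSq} := unitSq_meas.compl
  simp only [rho, Measure.coe_add, Pi.add_apply, Measure.coe_finsetSum, Finset.sum_apply,
    Measure.smul_apply, Measure.restrict_apply hm]
  simp only [Measure.dirac_apply' _ hm]
  rw [Finset.sum_eq_zero]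
  · have : {a | a ∉ unitSq} ∩ unitSq = ∅ := by ext; simp
    simp [this]
  · intro p hp
    simp [hP hp]

lemma L_eq (N : ℕ) (P : Finset (ℝ × ℝ)) (f : ℝ × ℝ → ℝ) (hf : IntegrableOn f unitSq) :
    ∫ x, sg P x * f x ∂(rho N P) = ∑ p ∈ P, f p - N * ∫ x in unitSq, f x := by
  have e : (fun x => sg P x * f x) =ᵐ[volume.restrict unitSq] fun x => - f x := by
    apply ae_restrict_of_ae
    have : ∀ᵐ x : ℝ × ℝ, x ∉ (P : Set (ℝ × ℝ)) := by
      rw [ae_iff]; simp [P.finite_toSet.measure_zero]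
    filter_upwards [this] with x hx
    have hx' : x ∉ P := hx
    simp [sg, hx']
  have i1 : Integrable (fun x => sg P x * f x) (∑ p ∈ P, Measure.dirac p) := by
    rw [integrable_finsetSum_measure]
    intro p hp
    exact integrable_dirac enorm_lt_top
  have i2 : Integrable (fun x => sg P x * f x) (volume.restrict unitSq) :=
    (hf.neg).congr e.symm
  rw [rho, integral_add_measure i1 (i2.smul_measure (by simp)), integral_smul_measure,
    integral_congr_ae e, integral_finsetSum_measure (fun p hp => integrable_dirac enorm_lt_top),
    integral_neg]
  simp only [integral_dirac, ENNReal.toReal_natCast, smul_eq_mul, mul_neg, ← sub_eq_add_neg]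
  congr 1
  apply Finset.sum_congr rfl
  intro p hp
  simp [sg, hp]

lemma L_ind (N : ℕ) (P : Finset (ℝ × ℝ)) (R : Set (ℝ × ℝ)) (hR : MeasurableSet R) :
    |∫ x, sg P x * R.indicator (fun _ => (1:ℝ)) x ∂(rho N P)| = localDisc N P R := by
  classical
  rw [L_eq]
  · unfold localDisc
    congr 2
    · have : (P : Set (ℝ × ℝ)) ∩ R = ((P.filter (· ∈ R) : Finset (ℝ × ℝ)) : Set (ℝ × ℝ)) := by
        ext; simp
      rw [this, Set.ncard_coe_finset, Finset.card_filter]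
      push_cast
      apply Finset.sum_congr rfl
      intro p hp
      simp [Set.indicator_apply]
    · congr 1
      have := integral_indicator_one (μ := volume.restrict unitSq) hR
      rw [Measure.real, Measure.restrict_apply hR] at this
      exact this
  · exact ((integrable_const (1:ℝ)).indicator hR)

/-- The energy density `|μ̂(ξ)|²`. -/
def En (N : ℕ) (P : Finset (ℝ × ℝ)) (ξ : ℝ × ℝ) : ℝ :=
  (∫ x, sg P x * Real.cos (ξ.1 * x.1 + ξ.2 * x.2) ∂(rho N P)) ^ 2 +
  (∫ x, sg P x * Real.sin (ξ.1 * x.1 + ξ.2 * x.2) ∂(rho N P)) ^ 2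

lemma En_nonneg (N : ℕ) (P : Finset (ℝ × ℝ)) (ξ : ℝ × ℝ) : 0 ≤ En N P ξ := by
  unfold En; positivity

lemma En_meas (N : ℕ) (P : Finset (ℝ × ℝ)) : Measurable (En N P) := by
  unfold En
  have hs : Measurable (fun p : (ℝ × ℝ) × (ℝ × ℝ) => sg P p.2) := (sg_meas P).comp measurable_snd
  apply Measurable.add <;> apply Measurable.pow_const
  · have : StronglyMeasurable (Function.uncurry fun (ξ x : ℝ × ℝ) => sg P x * Real.cos (ξ.1 * x.1 + ξ.2 * x.2)) :=
      (hs.mul (by fun_prop)).stronglyMeasurable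
    exact this.integral_prod_right.measurable
  · have : StronglyMeasurable (Function.uncurry fun (ξ x : ℝ × ℝ) => sg P x * Real.sin (ξ.1 * x.1 + ξ.2 * x.2)) :=
      (hs.mul (by fun_prop)).stronglyMeasurable
    exact this.integral_prod_right.measurable

lemma En_bdd (N : ℕ) (P : Finset (ℝ × ℝ)) : ∃ C, ∀ ξ, En N P ξ ≤ C := by
  refine ⟨((rho N P).real univ) ^ 2 + ((rho N P).real univ) ^ 2, fun ξ => ?_⟩
  have h : ∀ f : ℝ × ℝ → ℝ, (∀ x, |f x| ≤ 1) →
      (∫ x, sg P x * f x ∂(rho N P)) ^ 2 ≤ ((rho N P).real univ) ^ 2 := by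
    intro f hf
    apply sq_le_sq'
    all_goals
      have := norm_integral_le_of_norm_le_const (μ := rho N P) (f := fun x => sg P x * f x) (C := 1)
        (by filter_upwards with x
            rw [Real.norm_eq_abs, abs_mul]
            exact mul_le_one₀ (sg_abs P x) (abs_nonneg _) (hf x))
      rw [Real.norm_eq_abs, one_mul] at this
      have := abs_le.1 this
      linarith [this.1, this.2]
  exact add_le_add (h _ fun x => Real.abs_cos_le_one _) (h _ fun x => Real.abs_sin_le_one _)

lemma En_int (N : ℕ) (P : Finset (ℝ × ℝ)) (w : ℝ × ℝ → ℝ) (hw : Integrable w) :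
    Integrable (fun ξ => w ξ * En N P ξ) := by
  obtain ⟨C, hC⟩ := En_bdd N P
  refine hw.mul_bdd (c := C) (En_meas N P).aestronglyMeasurable ?_
  filter_upwards with ξ
  rw [Real.norm_of_nonneg (En_nonneg N P ξ)]; exact hC ξ

/-- The kernel dual to the weight `gw`. -/
def ker (b d τ : ℝ) (z : ℝ × ℝ) : ℝ :=
  √(π / b) * √(π / d) * (Real.exp (-(z.1 + τ * z.2) ^ 2 / (4 * b)) * Real.exp (-z.2 ^ 2 / (4 * d)))

lemma En_quad (N : ℕ) (P : Finset (ℝ × ℝ)) (b d τ : ℝ) (hb : 0 < b) (hd : 0 < d) :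
    ∫ ξ, gw b d τ ξ * En N P ξ =
      ∫ x, sg P x * ∫ x', sg P x' * ker b d τ (x - x') ∂(rho N P) ∂(rho N P) := by
  unfold En
  rw [quad_form (rho N P) volume (sg P) (sg_meas P) 1 (sg_abs P)
    (fun ξ x => ξ.1 * x.1 + ξ.2 * x.2) (by unfold Function.uncurry; fun_prop) (gw b d τ) (gw_int b d τ hb hd)]
  congr 1; ext x; congr 2; ext x'; congr 1
  rw [ker, ← gw_cos b d τ hb hd]
  congr 1; ext ξ; congr 2
  simp only [Prod.fst_sub, Prod.snd_sub]; ring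

lemma lower_gen (N : ℕ) (P : Finset (ℝ × ℝ)) (hP : P.card = N) (k : ℝ × ℝ → ℝ) (hk : Continuous k)
    (k0 : ∀ z, 0 ≤ k z) (K : ℝ) (kK : ∀ z, k z ≤ K) (ki : Integrable k) (c : ℝ) (hc : ∫ z, k z ≤ c) :
    N * k 0 - 2 * N ^ 2 * c ≤ ∫ x, sg P x * ∫ x', sg P x' * k (x - x') ∂(rho N P) ∂(rho N P) := by
  have kx : ∀ x, Integrable (fun y => k (x - y)) := fun x => ki.comp_sub_left x
  have ky : ∀ x, Integrable (fun y => k (y - x)) := fun x => ki.comp_sub_right x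
  have e : ∀ x, ∫ x', sg P x' * k (x - x') ∂(rho N P) =
      ∑ q ∈ P, k (x - q) - N * ∫ y in unitSq, k (x - y) := fun x =>
    L_eq N P (fun y => k (x - y)) (kx x).integrableOn
  simp_rw [e]
  have hm : Measurable (fun x => ∫ y in unitSq, k (x - y)) := by
    have : StronglyMeasurable (Function.uncurry fun (x y : ℝ × ℝ) => k (x - y)) := by
      apply Continuous.stronglyMeasurable
      unfold Function.uncurry; fun_prop
    exact this.integral_prod_right.measurable
  have J0 : ∀ x, 0 ≤ ∫ y in unitSq, k (x - y) := fun x => integral_nonneg fun y => k0 _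
  have Jc : ∀ x, ∫ y in unitSq, k (x - y) ≤ c := fun x =>
    (setIntegral_le_integral (kx x) (by filter_upwards with y using k0 _)).trans
      ((integral_sub_left_eq_self k volume x).trans_le hc)
  have i2 : IntegrableOn (fun x => (N:ℝ) * ∫ y in unitSq, k (x - y)) unitSq := by
    apply Integrable.const_mul
    refine (integrable_const c).mono' hm.aestronglyMeasurable ?_
    filter_upwards with x
    rw [Real.norm_of_nonneg (J0 x)]; exact Jc x
  have i1 : IntegrableOn (fun x => ∑ q ∈ P, k (x - q)) unitSq :=
    integrable_finsetSum _ fun q hq => (ky q).integrableOn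
  rw [L_eq N P (fun x => ∑ q ∈ P, k (x - q) - N * ∫ y in unitSq, k (x - y)) (i1.sub i2)]
  have c0 : 0 ≤ c := (integral_nonneg k0).trans hc
  have h1 : (N:ℝ) * (k 0 - N * c) ≤ ∑ p ∈ P, (∑ q ∈ P, k (p - q) - N * ∫ y in unitSq, k (p - y)) := by
    rw [← hP, ← nsmul_eq_mul]
    apply Finset.card_nsmul_le_sum
    intro p hp
    have : k (p - p) ≤ ∑ q ∈ P, k (p - q) :=
      Finset.single_le_sum (f := fun q => k (p - q)) (fun q _ => k0 _) hp
    rw [sub_self] at this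
    have := mul_le_mul_of_nonneg_left (Jc p) (Nat.cast_nonneg (α := ℝ) P.card)
    linarith
  have h2 : ∫ x in unitSq, (∑ q ∈ P, k (x - q) - N * ∫ y in unitSq, k (x - y)) ≤ N * c := by
    have : ∫ x in unitSq, (∑ q ∈ P, k (x - q) - N * ∫ y in unitSq, k (x - y)) ≤
        ∫ x in unitSq, ∑ q ∈ P, k (x - q) := by
      apply integral_mono (i1.sub i2) i1
      intro x
      have := mul_nonneg (Nat.cast_nonneg (α := ℝ) N) (J0 x)
      simp only [Pi.sub_apply]
      linarith
    refine this.trans ?_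
    rw [integral_finsetSum _ fun q hq => (ky q).integrableOn, ← hP, ← nsmul_eq_mul]
    apply Finset.sum_le_card_nsmul
    intro q hq
    exact (setIntegral_le_integral (ky q) (by filter_upwards with y using k0 _)).trans
      ((integral_sub_right_eq_self k q).trans_le hc)
  have h3 := mul_le_mul_of_nonneg_left h2 (Nat.cast_nonneg (α := ℝ) N)
  nlinarith

lemma ker_eq (b d τ : ℝ) (z : ℝ × ℝ) :
    ker b d τ z = √(π / b) * √(π / d) * gw (1 / (4 * d)) (1 / (4 * b)) (-τ) z.swap := by
  unfold ker gw
  simp only [Prod.fst_swap, Prod.snd_swap]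
  rw [mul_comm (Real.exp (-(z.1 + τ * z.2) ^ 2 / (4 * b)))]
  congr 3 <;> ring

lemma gw_total (b d τ : ℝ) (hb : 0 < b) (hd : 0 < d) : ∫ ξ, gw b d τ ξ = √(π / b) * √(π / d) := by
  have := gw_cos b d τ hb hd 0
  simpa using this

lemma lower_J (N : ℕ) (P : Finset (ℝ × ℝ)) (hP : P.card = N) (b d τ : ℝ) (hb : 0 < b) (hd : 0 < d) :
    N * (√(π / b) * √(π / d)) - 8 * π ^ 2 * N ^ 2 ≤ ∫ ξ, gw b d τ ξ * En N P ξ := by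
  rw [En_quad N P b d τ hb hd]
  have h4d : 0 < 1 / (4 * d) := by positivity
  have h4b : 0 < 1 / (4 * b) := by positivity
  have ki : Integrable (ker b d τ) := by
    have h : ker b d τ = fun z => √(π / b) * √(π / d) * gw (1 / (4 * d)) (1 / (4 * b)) (-τ) z.swap :=
      funext (ker_eq b d τ)
    rw [h]
    apply Integrable.const_mul
    have := gw_int (1 / (4 * d)) (1 / (4 * b)) (-τ) h4d h4b
    rw [Measure.volume_eq_prod] at this ⊢
    exact this.swap
  have kt : ∫ z, ker b d τ z ≤ 4 * π ^ 2 := by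
    simp_rw [ker_eq]
    rw [integral_const_mul]
    have : ∫ z : ℝ × ℝ, gw (1 / (4 * d)) (1 / (4 * b)) (-τ) z.swap = ∫ z, gw (1 / (4 * d)) (1 / (4 * b)) (-τ) z := by
      rw [Measure.volume_eq_prod]; exact integral_prod_swap _
    rw [this, gw_total _ _ _ h4d h4b]
    have e : √(π / b) * √(π / d) * (√(π / (1 / (4 * d))) * √(π / (1 / (4 * b)))) = 4 * π ^ 2 := by
      rw [← Real.sqrt_mul (by positivity), ← Real.sqrt_mul (by positivity), ← Real.sqrt_mul (by positivity)]
      rw [show π / b * (π / d) * (π / (1 / (4 * d)) * (π / (1 / (4 * b)))) = (4 * π ^ 2) ^ 2 by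
        field_simp]
      exact Real.sqrt_sq (by positivity)
    exact e.le
  have hl := lower_gen N P hP (ker b d τ) (by unfold ker; fun_prop) (fun z => by unfold ker; positivity)
    (√(π / b) * √(π / d)) (fun z => by
      unfold ker
      apply mul_le_of_le_one_right (by positivity)
      apply mul_le_one₀ _ (by positivity) _
      · rw [Real.exp_le_one_iff, neg_div]; exact neg_nonpos.2 (by positivity)
      · rw [Real.exp_le_one_iff, neg_div]; exact neg_nonpos.2 (by positivity)) ki (4 * π ^ 2) kt
  have : ker b d τ 0 = √(π / b) * √(π / d) := by simp [ker]
  rw [this] at hl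
  linarith

lemma exp_lvl (a : ℝ) (ha : 0 < a) (v w : ℝ) (hv : 0 < v) (hv1 : v ≤ 1) :
    v ≤ Real.exp (-a * w ^ 2) ↔ |w| ≤ √(-Real.log v / a) := by
  have hl : 0 ≤ -Real.log v := by have := Real.log_nonpos hv.le hv1; linarith
  rw [← Real.log_le_iff_le_exp hv, Real.le_sqrt (abs_nonneg w), sq_abs, le_div_iff₀ ha]
  · constructor <;> intro h <;> linarith
  · exact div_nonneg hl ha.le

lemma rot_zero (p : ℝ × ℝ) : rot 0 p = p := by simp [rot]

lemma rect_axis (N : ℕ) (P : Finset (ℝ × ℝ)) (θ Δ : ℝ) (hθ : 0 ≤ θ)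
    (hΔ : ∀ R, IsRectIn (Icc (-θ) θ) R → localDisc N P R ≤ Δ) (a b c d : ℝ) (hab : a ≤ b) (hcd : c ≤ d) :
    |∫ x, sg P x * (Icc a b ×ˢ Icc c d : Set (ℝ × ℝ)).indicator (fun _ => (1:ℝ)) x ∂(rho N P)| ≤ Δ := by
  rw [L_ind N P _ (measurableSet_Icc.prod measurableSet_Icc)]
  apply hΔ
  refine ⟨0, ⟨by linarith, hθ⟩, a, b, c, d, hab, hcd, ?_⟩
  have : rot 0 = id := funext rot_zero
  rw [this, image_id]

lemma exp_cake (e : ℝ) (h0 : 0 ≤ e) (h1 : e ≤ 1) :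
    ∫ v in Ioc (0:ℝ) 1, (if v ≤ e then (1:ℝ) else 0) = e := by
  have : (fun v : ℝ => if v ≤ e then (1:ℝ) else 0) = (Iic e).indicator 1 := by
    ext v; simp [Set.indicator_apply]
  rw [this, integral_indicator_one measurableSet_Iic, Measure.real, Measure.restrict_apply measurableSet_Iic]
  have : Iic e ∩ Ioc 0 1 = Ioc 0 e := by
    ext v; simp only [mem_inter_iff, mem_Iic, mem_Ioc]
    constructor
    · rintro ⟨h, h', h''⟩; exact ⟨h', h⟩
    · rintro ⟨h, h'⟩; exact ⟨h', h, h'.trans h1⟩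
  rw [this]; simp [h0]

lemma low_conv (N : ℕ) (P : Finset (ℝ × ℝ)) (θ Δ : ℝ) (hθ : 0 ≤ θ)
    (hΔ : ∀ R, IsRectIn (Icc (-θ) θ) R → localDisc N P R ≤ Δ) (a b : ℝ) (ha : 0 < a) (hb : 0 < b)
    (x : ℝ × ℝ) :
    |∫ y, sg P y * (Real.exp (-a * (x.1 - y.1) ^ 2) * Real.exp (-b * (x.2 - y.2) ^ 2)) ∂(rho N P)| ≤ Δ := by
  set m : Measure (ℝ × ℝ) := (volume.restrict (Ioc (0:ℝ) 1)).prod (volume.restrict (Ioc (0:ℝ) 1)) with hm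
  have hmr : m = volume.restrict (Ioc (0:ℝ) 1 ×ˢ Ioc (0:ℝ) 1) := by
    rw [hm, Measure.prod_restrict, Measure.volume_eq_prod]
  have hmu : m.real univ = 1 := by
    rw [hmr, Measure.real, Measure.restrict_apply_univ, Measure.volume_eq_prod, Measure.prod_prod]
    simp
  have e1 : ∀ y : ℝ × ℝ, sg P y * (Real.exp (-a * (x.1 - y.1) ^ 2) * Real.exp (-b * (x.2 - y.2) ^ 2)) =
      ∫ v, sg P y * ((if v.1 ≤ Real.exp (-a * (x.1 - y.1) ^ 2) then (1:ℝ) else 0) *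
        (if v.2 ≤ Real.exp (-b * (x.2 - y.2) ^ 2) then (1:ℝ) else 0)) ∂m := by
    intro y
    rw [integral_const_mul, hm, integral_prod_mul (fun v : ℝ => if v ≤ Real.exp (-a * (x.1 - y.1) ^ 2) then (1:ℝ) else 0)
      (fun v : ℝ => if v ≤ Real.exp (-b * (x.2 - y.2) ^ 2) then (1:ℝ) else 0), exp_cake, exp_cake]
    · positivity
    · rw [Real.exp_le_one_iff]; nlinarith [mul_nonneg hb.le (sq_nonneg (x.2 - y.2))]
    · positivity
    · rw [Real.exp_le_one_iff]; nlinarith [mul_nonneg ha.le (sq_nonneg (x.1 - y.1))]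
  simp_rw [e1]
  have hmeas : Measurable (fun p : (ℝ × ℝ) × (ℝ × ℝ) =>
      sg P p.1 * ((if p.2.1 ≤ Real.exp (-a * (x.1 - p.1.1) ^ 2) then (1:ℝ) else 0) *
        (if p.2.2 ≤ Real.exp (-b * (x.2 - p.1.2) ^ 2) then (1:ℝ) else 0))) := by
    apply ((sg_meas P).comp measurable_fst).mul
    apply Measurable.mul
    · exact Measurable.ite (measurableSet_le (by fun_prop) (by fun_prop)) measurable_const measurable_const
    · exact Measurable.ite (measurableSet_le (by fun_prop) (by fun_prop)) measurable_const measurable_const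
  rw [integral_integral_swap]
  · have := norm_integral_le_of_norm_le_const (μ := m) (C := Δ) (f := fun v => ∫ y, sg P y *
      ((if v.1 ≤ Real.exp (-a * (x.1 - y.1) ^ 2) then (1:ℝ) else 0) *
        (if v.2 ≤ Real.exp (-b * (x.2 - y.2) ^ 2) then (1:ℝ) else 0)) ∂(rho N P)) ?_
    · rw [hmu, mul_one] at this; exact this
    · rw [hmr]
      filter_upwards [ae_restrict_mem (measurableSet_Ioc.prod measurableSet_Ioc)] with v hv
      obtain ⟨⟨h1, h2⟩, h3, h4⟩ := hv
      set r1 := √(-Real.log v.1 / a)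
      set r2 := √(-Real.log v.2 / b)
      have r10 : 0 ≤ r1 := Real.sqrt_nonneg _
      have r20 : 0 ≤ r2 := Real.sqrt_nonneg _
      have := rect_axis N P θ Δ hθ hΔ (x.1 - r1) (x.1 + r1) (x.2 - r2) (x.2 + r2) (by linarith) (by linarith)
      rw [Real.norm_eq_abs]
      convert this using 5 with y
      rw [Set.indicator_apply]
      simp only [exp_lvl a ha _ _ h1 h2, exp_lvl b hb _ _ h3 h4, mem_prod, mem_Icc]
      have q1 : |x.1 - y.1| ≤ r1 ↔ x.1 - r1 ≤ y.1 ∧ y.1 ≤ x.1 + r1 := by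
        rw [abs_le]; constructor <;> rintro ⟨h, h'⟩ <;> constructor <;> linarith
      have q2 : |x.2 - y.2| ≤ r2 ↔ x.2 - r2 ≤ y.2 ∧ y.2 ≤ x.2 + r2 := by
        rw [abs_le]; constructor <;> rintro ⟨h, h'⟩ <;> constructor <;> linarith
      change (if |x.1 - y.1| ≤ r1 then (1:ℝ) else 0) * (if |x.2 - y.2| ≤ r2 then (1:ℝ) else 0) = _
      simp only [q1, q2, ite_and]
      split_ifs <;> simp
  · refine (integrable_const (1:ℝ)).mono' hmeas.aestronglyMeasurable ?_
    filter_upwards with p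
    simp only [Function.uncurry]
    rw [Real.norm_eq_abs, abs_mul]
    apply mul_le_one₀ (sg_abs P _) (abs_nonneg _)
    split_ifs <;> simp

lemma low_J (N : ℕ) (P : Finset (ℝ × ℝ)) (hP : P.card = N) (θ Δ : ℝ) (hθ : 0 ≤ θ)
    (hΔ : ∀ R, IsRectIn (Icc (-θ) θ) R → localDisc N P R ≤ Δ) (b d : ℝ) (hb : 0 < b) (hd : 0 < d) :
    ∫ ξ, gw b d 0 ξ * En N P ξ ≤ (√(π / b) * √(π / d)) * Δ * (2 * N) := by
  rw [En_quad N P b d 0 hb hd]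
  rw [← rho_univ N P hP]
  refine (Real.le_norm_self _).trans ?_
  apply norm_integral_le_of_norm_le_const
  filter_upwards with x
  have h := low_conv N P θ Δ hθ hΔ (1 / (4 * b)) (1 / (4 * d)) (by positivity) (by positivity) x
  have e : ∀ y, sg P y * ker b d 0 (x - y) = (√(π / b) * √(π / d)) *
      (sg P y * (Real.exp (-(1 / (4 * b)) * (x.1 - y.1) ^ 2) * Real.exp (-(1 / (4 * d)) * (x.2 - y.2) ^ 2))) := by
    intro y
    unfold ker
    have e1 : -((x - y).1 + 0 * (x - y).2) ^ 2 / (4 * b) = -(1 / (4 * b)) * (x.1 - y.1) ^ 2 := by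
      simp only [Prod.fst_sub]; ring
    have e2 : -(x - y).2 ^ 2 / (4 * d) = -(1 / (4 * d)) * (x.2 - y.2) ^ 2 := by
      simp only [Prod.snd_sub]; ring
    rw [e1, e2]; ring
  simp_rw [e]
  rw [integral_const_mul, norm_mul, norm_mul, Real.norm_eq_abs (∫ _, _ ∂_)]
  have hc : 0 ≤ √(π / b) * √(π / d) := by positivity
  rw [Real.norm_of_nonneg hc]
  calc |sg P x| * (√(π / b) * √(π / d) * _) ≤ 1 * (√(π / b) * √(π / d) * Δ) := by
        apply mul_le_mul (sg_abs P x) (mul_le_mul_of_nonneg_left h hc) (by positivity) zero_le_one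
    _ = _ := one_mul _

lemma mem_rot_image (ω : ℝ) (S : Set (ℝ × ℝ)) (p : ℝ × ℝ) :
    p ∈ rot ω '' S ↔ (p.1 * Real.cos ω + p.2 * Real.sin ω, -p.1 * Real.sin ω + p.2 * Real.cos ω) ∈ S := by
  have hcs := Real.sin_sq_add_cos_sq ω
  constructor
  · rintro ⟨q, hq, rfl⟩
    convert hq using 1
    ext
    · simp only [rot]; linear_combination q.1 * hcs
    · simp only [rot]; linear_combination q.2 * hcs
  · intro h
    refine ⟨_, h, ?_⟩
    ext
    · simp only [rot]; linear_combination p.1 * hcs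
    · simp only [rot]; linear_combination p.2 * hcs

/-- Discrepancy of half planes. -/
lemma half_plane (N : ℕ) (P : Finset (ℝ × ℝ)) (hPs : ↑P ⊆ unitSq) (θ Δ : ℝ)
    (hΔ : ∀ R, IsRectIn (Icc (-θ) θ) R → localDisc N P R ≤ Δ) (κ t : ℝ) (hκ : |κ| ≤ θ) :
    |∫ x, sg P x * ({x : ℝ × ℝ | x.1 + κ * x.2 ≤ t}).indicator (fun _ => (1:ℝ)) x ∂(rho N P)| ≤ Δ := by
  rw [L_ind N P _ (measurableSet_le (by fun_prop) (by fun_prop))]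
  set ω := Real.arctan κ with hω
  have hcos : 0 < Real.cos ω := Real.cos_arctan_pos κ
  have hsin : Real.sin ω = κ * Real.cos ω := by
    have := Real.tan_arctan κ
    rw [Real.tan_eq_sin_div_cos] at this
    rw [hω]; field_simp at this
    linarith
  have hωκ : |ω| ≤ |κ| := by
    have h0 : ∀ y : ℝ, 0 ≤ y → Real.arctan y ≤ y := by
      intro y hy
      have h1 : 0 ≤ Real.arctan y := Real.arctan_nonneg.2 hy
      have := Real.le_tan h1 (Real.arctan_lt_pi_div_two y)
      rwa [Real.tan_arctan] at this
    rcases le_total 0 κ with h | h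
    · rw [abs_of_nonneg h, abs_of_nonneg (Real.arctan_nonneg.2 h)]; exact h0 κ h
    · have : ω ≤ 0 := by
        have := Real.arctan_nonneg.2 (neg_nonneg.2 h)
        rw [Real.arctan_neg] at this; linarith
      rw [abs_of_nonpos h, abs_of_nonpos this, hω, ← Real.arctan_neg]
      exact h0 _ (by linarith)
  set R := rot ω '' (Icc (min (-10) (t * Real.cos ω)) (t * Real.cos ω) ×ˢ Icc (-10) 10) with hR
  have hloc : localDisc N P {x : ℝ × ℝ | x.1 + κ * x.2 ≤ t} = localDisc N P R := by
    have key : ∀ x ∈ unitSq, x ∈ {x : ℝ × ℝ | x.1 + κ * x.2 ≤ t} ↔ x ∈ R := by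
      rintro x ⟨⟨h1, h2⟩, h3, h4⟩
      rw [hR, mem_rot_image, mem_ofPred_eq]
      have hc1 := Real.cos_le_one ω
      have hs1 := Real.sin_le_one ω
      have hs2 := Real.neg_one_le_sin ω
      have e : x.1 * Real.cos ω + x.2 * Real.sin ω = (x.1 + κ * x.2) * Real.cos ω := by rw [hsin]; ring
      simp only [mem_prod, mem_Icc]
      constructor
      · intro h
        refine ⟨⟨?_, ?_⟩, ?_, ?_⟩
        · apply (min_le_left _ _).trans; nlinarith
        · rw [e]; exact mul_le_mul_of_nonneg_right h hcos.le
        · nlinarith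
        · nlinarith
      · rintro ⟨⟨_, h⟩, _⟩
        rw [e] at h
        exact le_of_mul_le_mul_right h hcos
    unfold localDisc
    have i1 : (P : Set (ℝ × ℝ)) ∩ {x : ℝ × ℝ | x.1 + κ * x.2 ≤ t} = ↑P ∩ R := by
      ext x; constructor
      · rintro ⟨h, h'⟩; exact ⟨h, (key x (hPs h)).1 h'⟩
      · rintro ⟨h, h'⟩; exact ⟨h, (key x (hPs h)).2 h'⟩
    have i2 : {x : ℝ × ℝ | x.1 + κ * x.2 ≤ t} ∩ unitSq = R ∩ unitSq := by
      ext x; constructor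
      · rintro ⟨h', h⟩; exact ⟨(key x h).1 h', h⟩
      · rintro ⟨h', h⟩; exact ⟨(key x h).2 h', h⟩
    rw [i1, i2]
  rw [hloc]
  apply hΔ
  refine ⟨ω, abs_le.1 (hωκ.trans hκ), _, _, _, _, min_le_right _ _, by norm_num, hR⟩

/-- distribution function of the projected discrepancy measure -/
def MM (N : ℕ) (P : Finset (ℝ × ℝ)) (κ t : ℝ) : ℝ :=
  ∫ x, sg P x * ({x : ℝ × ℝ | x.1 + κ * x.2 ≤ t}).indicator (fun _ => (1:ℝ)) x ∂(rho N P)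

lemma MM_unc (P : Finset (ℝ × ℝ)) (κ : ℝ) : Measurable (fun p : ℝ × (ℝ × ℝ) => sg P p.2 *
    ({x : ℝ × ℝ | x.1 + κ * x.2 ≤ p.1}).indicator (fun _ => (1:ℝ)) p.2) := by
  apply ((sg_meas P).comp measurable_snd).mul
  simp only [Set.indicator_apply, mem_ofPred_eq]
  exact Measurable.ite (measurableSet_le (by fun_prop) (by fun_prop)) measurable_const measurable_const

lemma MM_meas (N : ℕ) (P : Finset (ℝ × ℝ)) (κ : ℝ) : Measurable (MM N P κ) := by
  have : StronglyMeasurable (Function.uncurry fun (t : ℝ) (x : ℝ × ℝ) => sg P x *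
    ({x : ℝ × ℝ | x.1 + κ * x.2 ≤ t}).indicator (fun _ => (1:ℝ)) x) := (MM_unc P κ).stronglyMeasurable
  exact this.integral_prod_right.measurable

lemma by_parts (N : ℕ) (P : Finset (ℝ × ℝ)) (hP : P.card = N) (hPs : ↑P ⊆ unitSq) (κ : ℝ) (hκ : |κ| ≤ 1)
    (f f' : ℝ → ℝ) (hf : ∀ t, HasDerivAt f (f' t) t) (hf' : Continuous f') :
    ∫ x, sg P x * f (x.1 + κ * x.2) ∂(rho N P) = - ∫ t in Icc (-1:ℝ) 2, MM N P κ t * f' t := by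
  have fc : Continuous f := continuous_iff_continuousAt.2 fun t => (hf t).continuousAt
  have tot : ∫ x, sg P x * f 2 ∂(rho N P) = 0 := by
    rw [L_eq N P (fun _ => f 2) (integrable_const _)]
    simp [hP, Measure.real, unitSq_vol]
  have i1 : Integrable (fun t => f' t) (volume.restrict (Icc (-1:ℝ) 2)) :=
    hf'.continuousOn.integrableOn_Icc
  have ig : Integrable (fun p : ℝ × (ℝ × ℝ) => (sg P p.2 *
    ({x : ℝ × ℝ | x.1 + κ * x.2 ≤ p.1}).indicator (fun _ => (1:ℝ)) p.2) * f' p.1)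
    ((volume.restrict (Icc (-1:ℝ) 2)).prod (rho N P)) := by
    have h0 : Integrable (fun p : ℝ × (ℝ × ℝ) => f' p.1) ((volume.restrict (Icc (-1:ℝ) 2)).prod (rho N P)) :=
      i1.comp_fst _
    refine h0.bdd_mul (c := 1) (MM_unc P κ).aestronglyMeasurable ?_
    filter_upwards with p
    rw [Real.norm_eq_abs, abs_mul]
    apply mul_le_one₀ (sg_abs P _) (abs_nonneg _)
    rw [Set.indicator_apply]; split_ifs <;> simp
  unfold MM
  simp_rw [← integral_mul_const]
  rw [integral_integral_swap ig]
  have ae1 : (fun x => sg P x * f (x.1 + κ * x.2)) =ᵐ[rho N P] fun x => sg P x * f 2 -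
      ∫ t in Icc (-1:ℝ) 2, (sg P x * ({x : ℝ × ℝ | x.1 + κ * x.2 ≤ t}).indicator (fun _ => (1:ℝ)) x) * f' t := by
    filter_upwards [rho_ae N P hPs] with x hx
    obtain ⟨⟨h1, h2⟩, h3, h4⟩ := hx
    have hk := abs_le.1 hκ
    set u := x.1 + κ * x.2 with hu
    have u1 : -1 ≤ u := by rw [hu]; nlinarith
    have u2 : u ≤ 2 := by rw [hu]; nlinarith
    have e1 : ∀ t, (sg P x * ({x : ℝ × ℝ | x.1 + κ * x.2 ≤ t}).indicator (fun _ => (1:ℝ)) x) * f' t =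
        sg P x * (Ici u).indicator f' t := by
      intro t
      simp only [Set.indicator_apply, mem_ofPred_eq, mem_Ici, ← hu]
      split_ifs <;> ring
    simp_rw [e1]
    rw [integral_const_mul, integral_indicator measurableSet_Ici, Measure.restrict_restrict measurableSet_Ici]
    have : Ici u ∩ Icc (-1) 2 = Icc u 2 := by
      ext t; simp only [mem_inter_iff, mem_Ici, mem_Icc]
      constructor
      · rintro ⟨a, b, c⟩; exact ⟨a, c⟩
      · rintro ⟨a, c⟩; exact ⟨a, by linarith, c⟩
    rw [this, integral_Icc_eq_integral_Ioc, ← intervalIntegral.integral_of_le u2,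
      intervalIntegral.integral_eq_sub_of_hasDerivAt (fun t _ => hf t) (hf'.intervalIntegrable _ _)]
    ring
  rw [integral_congr_ae ae1, integral_sub, tot, zero_sub]
  · exact ((integrable_const (1:ℝ)).mono' (sg_meas P).aestronglyMeasurable
      (by filter_upwards with x using sg_abs P x)).mul_const _
  · exact ig.integral_prod_right

lemma En_cone (N : ℕ) (P : Finset (ℝ × ℝ)) (hP : P.card = N) (hPs : ↑P ⊆ unitSq) (κ : ℝ) (hκ : |κ| ≤ 1) (s : ℝ) :
    En N P (s, s * κ) = s ^ 2 * ((∫ t in Icc (-1:ℝ) 2, MM N P κ t * Real.cos (s * t)) ^ 2 +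
      (∫ t in Icc (-1:ℝ) 2, MM N P κ t * Real.sin (s * t)) ^ 2) := by
  have h1 := by_parts N P hP hPs κ hκ (fun t => Real.cos (s * t)) (fun t => -s * Real.sin (s * t))
    (fun t => (((hasDerivAt_id t).const_mul s).cos).congr_deriv (by simp only [id, mul_one]; ring)) (by fun_prop)
  have h2 := by_parts N P hP hPs κ hκ (fun t => Real.sin (s * t)) (fun t => s * Real.cos (s * t))
    (fun t => (((hasDerivAt_id t).const_mul s).sin).congr_deriv (by simp only [id, mul_one]; ring)) (by fun_prop)
  have e1 : ∀ t, MM N P κ t * (-s * Real.sin (s * t)) = -s * (MM N P κ t * Real.sin (s * t)) := fun t => by ring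
  have e2 : ∀ t, MM N P κ t * (s * Real.cos (s * t)) = s * (MM N P κ t * Real.cos (s * t)) := fun t => by ring
  simp_rw [e1] at h1
  simp_rw [e2] at h2
  rw [integral_const_mul] at h1 h2
  unfold En
  have e3 : ∀ x : ℝ × ℝ, s * x.1 + s * κ * x.2 = s * (x.1 + κ * x.2) := fun x => by ring
  simp only [e3]
  rw [h1, h2]; ring

lemma cone_J (N : ℕ) (P : Finset (ℝ × ℝ)) (hPs : ↑P ⊆ unitSq) (θ Δ : ℝ)
    (hΔ : ∀ R, IsRectIn (Icc (-θ) θ) R → localDisc N P R ≤ Δ) (κ : ℝ) (hκ : |κ| ≤ θ) (β : ℝ) (hβ : 0 < β) :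
    ∫ s, Real.exp (-β * s ^ 2) * ((∫ t in Icc (-1:ℝ) 2, MM N P κ t * Real.cos (s * t)) ^ 2 +
      (∫ t in Icc (-1:ℝ) 2, MM N P κ t * Real.sin (s * t)) ^ 2) ≤ 6 * π * Δ ^ 2 := by
  have hM : ∀ t, |MM N P κ t| ≤ Δ := fun t => half_plane N P hPs θ Δ hΔ κ t hκ
  have hΔ0 : 0 ≤ Δ := (abs_nonneg _).trans (hM 0)
  rw [quad_form (volume.restrict (Icc (-1:ℝ) 2)) volume (MM N P κ) (MM_meas N P κ) Δ hM
    (fun s t => s * t) (by unfold Function.uncurry; fun_prop) _ (gint β hβ)]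
  have hker : ∀ t t' : ℝ, ∫ s : ℝ, Real.exp (-β * s ^ 2) * Real.cos (s * t - s * t') =
      √(π / β) * Real.exp (-(1 / (4 * β)) * (t - t') ^ 2) := by
    intro t t'
    simp_rw [← mul_sub]
    rw [(gauss_cis β hβ (t - t')).1]
    congr 2; ring
  simp_rw [hker]
  have hb4 : 0 < 1 / (4 * β) := by positivity
  have inner : ∀ t, ‖∫ t' in Icc (-1:ℝ) 2, MM N P κ t' * (√(π / β) * Real.exp (-(1 / (4 * β)) * (t - t') ^ 2))‖
      ≤ Δ * (2 * π) := by
    intro t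
    have gi : Integrable (fun t' : ℝ => Real.exp (-(1 / (4 * β)) * (t - t') ^ 2)) :=
      (gint _ hb4).comp_sub_left t
    have : ‖∫ t' in Icc (-1:ℝ) 2, MM N P κ t' * (√(π / β) * Real.exp (-(1 / (4 * β)) * (t - t') ^ 2))‖ ≤
        ∫ t' in Icc (-1:ℝ) 2, Δ * (√(π / β) * Real.exp (-(1 / (4 * β)) * (t - t') ^ 2)) := by
      apply norm_integral_le_of_norm_le
      · exact ((gi.const_mul _).const_mul _).integrableOn
      · filter_upwards with t'
        rw [norm_mul, Real.norm_eq_abs, Real.norm_of_nonneg (by positivity)]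
        exact mul_le_mul_of_nonneg_right (hM t') (by positivity)
    refine this.trans ?_
    refine (setIntegral_le_integral ((gi.const_mul _).const_mul _)
      (by filter_upwards with t'; exact mul_nonneg hΔ0 (by positivity))).trans ?_
    rw [integral_const_mul, integral_const_mul]
    apply mul_le_mul_of_nonneg_left _ hΔ0
    rw [integral_sub_left_eq_self (fun y : ℝ => Real.exp (-(1 / (4 * β)) * y ^ 2)) volume t, integral_gaussian,
      ← Real.sqrt_mul (by positivity)]
    rw [show π / β * (π / (1 / (4 * β))) = (2 * π) ^ 2 by field_simp; ring]
    exact (Real.sqrt_sq (by positivity)).le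
  refine (Real.le_norm_self _).trans ?_
  have := norm_integral_le_of_norm_le_const (μ := volume.restrict (Icc (-1:ℝ) 2)) (C := Δ * (Δ * (2 * π)))
    (f := fun t => MM N P κ t * ∫ t' in Icc (-1:ℝ) 2, MM N P κ t' * (√(π / β) * Real.exp (-(1 / (4 * β)) * (t - t') ^ 2)))
    (by
      filter_upwards with t
      rw [norm_mul]
      exact mul_le_mul (hM t) (inner t) (norm_nonneg _) hΔ0)
  refine this.trans (le_of_eq ?_)
  rw [Measure.real, Measure.restrict_apply_univ, Real.volume_Icc, ENNReal.toReal_ofReal (by norm_num)]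
  ring

lemma exp_sq_bd (b s : ℝ) (hb : 0 < b) :
    Real.exp (-b * s ^ 2) * s ^ 2 ≤ (1 / b) * Real.exp (-(b / 2) * s ^ 2) := by
  have h1 : b * s ^ 2 ≤ Real.exp ((b / 2) * s ^ 2) := by
    have h := Real.add_one_le_exp ((b / 4) * s ^ 2)
    have h0 : 0 ≤ b * s ^ 2 := by positivity
    have e : Real.exp ((b / 2) * s ^ 2) = Real.exp ((b / 4) * s ^ 2) ^ 2 := by
      rw [← Real.exp_nat_mul]; congr 1; push_cast; ring
    rw [e]
    nlinarith [sq_nonneg ((b / 4) * s ^ 2 - 1)]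
  have e : Real.exp (-(b / 2) * s ^ 2) = Real.exp (-b * s ^ 2) * Real.exp ((b / 2) * s ^ 2) := by
    rw [← Real.exp_add]; congr 1; ring
  rw [e, one_div, inv_mul_eq_div, le_div_iff₀ hb]
  have := mul_le_mul_of_nonneg_left h1 (Real.exp_pos (-b * s ^ 2)).le
  linarith

lemma cone_l (N : ℕ) (P : Finset (ℝ × ℝ)) (hP : P.card = N) (hPs : ↑P ⊆ unitSq) (θ Δ : ℝ) (hθ1 : θ ≤ 1)
    (hΔ : ∀ R, IsRectIn (Icc (-θ) θ) R → localDisc N P R ≤ Δ) (κ : ℝ) (hκ : |κ| ≤ θ) (b : ℝ) (hb : 0 < b) :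
    ∫⁻ s, ENNReal.ofReal (Real.exp (-b * s ^ 2) * En N P (s, s * κ)) ≤ ENNReal.ofReal ((1 / b) * (6 * π * Δ ^ 2)) := by
  have hM : ∀ t, |MM N P κ t| ≤ Δ := fun t => half_plane N P hPs θ Δ hΔ κ t hκ
  set B : ℝ → ℝ := fun s => (∫ t in Icc (-1:ℝ) 2, MM N P κ t * Real.cos (s * t)) ^ 2 +
      (∫ t in Icc (-1:ℝ) 2, MM N P κ t * Real.sin (s * t)) ^ 2 with hB
  have hB0 : ∀ s, 0 ≤ B s := fun s => by rw [hB]; positivity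
  have hmM : Measurable (fun p : ℝ × ℝ => MM N P κ p.2) := (MM_meas N P κ).comp measurable_snd
  have hBm : Measurable B := by
    apply Measurable.add <;> apply Measurable.pow_const
    · have : StronglyMeasurable (Function.uncurry fun (s t : ℝ) => MM N P κ t * Real.cos (s * t)) :=
        (hmM.mul (by fun_prop)).stronglyMeasurable
      exact this.integral_prod_right.measurable
    · have : StronglyMeasurable (Function.uncurry fun (s t : ℝ) => MM N P κ t * Real.sin (s * t)) :=
        (hmM.mul (by fun_prop)).stronglyMeasurable
      exact this.integral_prod_right.measurable
  have hΔ0 : 0 ≤ Δ := (abs_nonneg _).trans (hM 0)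
  have hBb : ∀ s, B s ≤ (Δ * (volume.restrict (Icc (-1:ℝ) 2)).real univ) ^ 2 +
      (Δ * (volume.restrict (Icc (-1:ℝ) 2)).real univ) ^ 2 := by
    intro s
    have h : ∀ f : ℝ → ℝ, (∀ x, |f x| ≤ 1) →
        (∫ t in Icc (-1:ℝ) 2, MM N P κ t * f t) ^ 2 ≤ (Δ * (volume.restrict (Icc (-1:ℝ) 2)).real univ) ^ 2 := by
      intro f hf
      have := norm_integral_le_of_norm_le_const (μ := volume.restrict (Icc (-1:ℝ) 2))
        (f := fun t => MM N P κ t * f t) (C := Δ)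
        (by filter_upwards with x
            rw [Real.norm_eq_abs, abs_mul]
            calc _ ≤ Δ * 1 := mul_le_mul (hM x) (hf x) (abs_nonneg _) hΔ0
              _ = Δ := mul_one _)
      rw [Real.norm_eq_abs] at this
      have := abs_le.1 this
      exact sq_le_sq' this.1 this.2
    exact add_le_add (h _ fun x => Real.abs_cos_le_one _) (h _ fun x => Real.abs_sin_le_one _)
  have hb2 : 0 < b / 2 := by positivity
  have hBint : Integrable (fun s => Real.exp (-(b / 2) * s ^ 2) * B s) := by
    refine (gint (b / 2) hb2).mul_bdd (c := (Δ * (volume.restrict (Icc (-1:ℝ) 2)).real univ) ^ 2 +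
      (Δ * (volume.restrict (Icc (-1:ℝ) 2)).real univ) ^ 2) hBm.aestronglyMeasurable ?_
    · filter_upwards with s
      rw [Real.norm_of_nonneg (hB0 s)]; exact hBb s
  calc ∫⁻ s, ENNReal.ofReal (Real.exp (-b * s ^ 2) * En N P (s, s * κ))
      ≤ ∫⁻ s, ENNReal.ofReal ((1 / b) * (Real.exp (-(b / 2) * s ^ 2) * B s)) := by
        apply lintegral_mono
        intro s
        apply ENNReal.ofReal_le_ofReal
        rw [En_cone N P hP hPs κ (hκ.trans hθ1) s]
        have := mul_le_mul_of_nonneg_right (exp_sq_bd b s hb) (hB0 s)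
        calc _ = Real.exp (-b * s ^ 2) * s ^ 2 * B s := by rw [hB]; ring
          _ ≤ _ := this
          _ = _ := by ring
    _ = ENNReal.ofReal (∫ s, (1 / b) * (Real.exp (-(b / 2) * s ^ 2) * B s)) := by
        rw [ofReal_integral_eq_lintegral_ofReal (hBint.const_mul _)]
        filter_upwards with s
        have := hB0 s
        simp only [Pi.zero_apply]; positivity
    _ ≤ _ := by
        apply ENNReal.ofReal_le_ofReal
        rw [integral_const_mul]
        exact mul_le_mul_of_nonneg_left (cone_J N P hPs θ Δ hΔ κ hκ (b / 2) hb2) (by positivity)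

lemma lint_scale (s : ℝ) (hs : s ≠ 0) (g : ℝ → ENNReal) (hg : Measurable g) :
    ∫⁻ y, g y = ENNReal.ofReal |s| * ∫⁻ κ, g (s * κ) := by
  conv_lhs => rw [← Real.smul_map_volume_mul_left hs]
  rw [lintegral_smul_measure, lintegral_map hg (by fun_prop)]
  rfl

lemma tau_int (d s y : ℝ) (hd : 0 < d) (hs : s ≠ 0) :
    ∫⁻ τ : ℝ, ENNReal.ofReal (Real.exp (-d * (y - τ * s) ^ 2)) = ENNReal.ofReal (√(π / d) / |s|) := by
  have hds : 0 < d * s ^ 2 := by positivity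
  have e : ∀ τ, Real.exp (-d * (y - τ * s) ^ 2) = Real.exp (-(d * s ^ 2) * (τ - y / s) ^ 2) := by
    intro τ; congr 1; field_simp; ring
  simp_rw [e]
  rw [← ofReal_integral_eq_lintegral_ofReal ((gint _ hds).comp_sub_right (y / s))
    (by filter_upwards with τ; positivity),
    integral_sub_right_eq_self (fun τ : ℝ => Real.exp (-(d * s ^ 2) * τ ^ 2)), integral_gaussian,
    ← div_div, Real.sqrt_div (by positivity), Real.sqrt_sq_eq_abs]

/-- The cone of frequencies. -/
def cone (θ : ℝ) : Set (ℝ × ℝ) := {ξ | |ξ.2| ≤ θ * |ξ.1|}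

lemma cone_meas (θ : ℝ) : MeasurableSet (cone θ) :=
  measurableSet_le (by fun_prop) (by fun_prop)

lemma gw_out (b d θ τ : ℝ) (hb : 0 < b) (hd : 0 < d) (hτ : |τ| ≤ θ / 2) (ξ : ℝ × ℝ)
    (hξ : ξ ∉ cone θ) : gw b d τ ξ ≤ gw (d * θ ^ 2 / 8) (d / 8) 0 ξ := by
  have h : θ * |ξ.1| < |ξ.2| := not_le.1 hξ
  have h1 : |ξ.2| / 2 ≤ |ξ.2 - τ * ξ.1| := by
    have h2 := abs_sub_abs_le_abs_sub ξ.2 (τ * ξ.1)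
    rw [abs_mul] at h2
    have := mul_le_mul_of_nonneg_right hτ (abs_nonneg ξ.1)
    linarith
  have hθ : 0 ≤ θ := by have := abs_nonneg τ; linarith
  have h3 : ξ.2 ^ 2 / 4 ≤ (ξ.2 - τ * ξ.1) ^ 2 := by
    rw [← sq_abs ξ.2, ← sq_abs (ξ.2 - τ * ξ.1)]
    have := abs_nonneg ξ.2
    nlinarith
  have h4 : θ ^ 2 * ξ.1 ^ 2 ≤ ξ.2 ^ 2 := by
    rw [← sq_abs ξ.2, ← sq_abs ξ.1, ← mul_pow]
    exact pow_le_pow_left₀ (by positivity) h.le 2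
  unfold gw
  rw [← Real.exp_add, ← Real.exp_add]
  apply Real.exp_le_exp.2
  have h5 := mul_le_mul_of_nonneg_left h3 hd.le
  have h6 := mul_le_mul_of_nonneg_left h4 hd.le
  have h7 := mul_nonneg hb.le (sq_nonneg ξ.1)
  nlinarith

lemma gw_nonneg (b d τ : ℝ) (ξ : ℝ × ℝ) : 0 ≤ gw b d τ ξ := by unfold gw; positivity

set_option maxHeartbeats 2000000 in
lemma main_ineq (N : ℕ) (P : Finset (ℝ × ℝ)) (hP : P.card = N) (hPs : ↑P ⊆ unitSq) (θ Δ : ℝ)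
    (hθ : 0 < θ) (hθ1 : θ ≤ 1)
    (hΔ : ∀ R, IsRectIn (Icc (-θ) θ) R → localDisc N P R ≤ Δ) (hΔ0 : 0 ≤ Δ) (b d : ℝ) (hb : 0 < b) (hd : 0 < d) :
    N * (√(π / b) * √(π / d)) - 8 * π ^ 2 * N ^ 2 ≤
      (√(π / (d * θ ^ 2 / 8)) * √(π / (d / 8))) * Δ * (2 * N) + 2 * √(π / d) * ((1 / b) * (6 * π * Δ ^ 2)) := by
  set lo := N * (√(π / b) * √(π / d)) - 8 * π ^ 2 * N ^ 2 with hlo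
  set low := (√(π / (d * θ ^ 2 / 8)) * √(π / (d / 8))) * Δ * (2 * N) with hlow
  have low0 : 0 ≤ low := by positivity
  have hb1 : 0 < d * θ ^ 2 / 8 := by positivity
  have hb2 : 0 < d / 8 := by positivity
  have conv : ∀ b d τ : ℝ, 0 < b → 0 < d → ENNReal.ofReal (∫ ξ, gw b d τ ξ * En N P ξ) =
      ∫⁻ ξ, ENNReal.ofReal (gw b d τ ξ * En N P ξ) := by
    intro b d τ hb hd
    apply ofReal_integral_eq_lintegral_ofReal (En_int N P _ (gw_int b d τ hb hd))
    filter_upwards with ξ using mul_nonneg (gw_nonneg _ _ _ _) (En_nonneg _ _ _)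
  have lowm : ∫⁻ ξ, ENNReal.ofReal (gw (d * θ ^ 2 / 8) (d / 8) 0 ξ * En N P ξ) ≤ ENNReal.ofReal low := by
    rw [← conv _ _ _ hb1 hb2]
    exact ENNReal.ofReal_le_ofReal (low_J N P hP θ Δ hθ.le hΔ _ _ hb1 hb2)
  have mgE : ∀ b d τ, Measurable (fun ξ => ENNReal.ofReal (gw b d τ ξ * En N P ξ)) := fun b d τ =>
    ((gw_cont b d τ).measurable.mul (En_meas N P)).ennreal_ofReal
  have step1 : ∀ τ ∈ Icc (-(θ / 2)) (θ / 2), ENNReal.ofReal lo ≤ ENNReal.ofReal low +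
      ∫⁻ ξ in cone θ, ENNReal.ofReal (gw b d τ ξ * En N P ξ) := by
    intro τ hτ
    calc ENNReal.ofReal lo ≤ ENNReal.ofReal (∫ ξ, gw b d τ ξ * En N P ξ) :=
          ENNReal.ofReal_le_ofReal (lower_J N P hP b d τ hb hd)
      _ = ∫⁻ ξ, ENNReal.ofReal (gw b d τ ξ * En N P ξ) := conv b d τ hb hd
      _ ≤ ∫⁻ ξ, (ENNReal.ofReal (gw (d * θ ^ 2 / 8) (d / 8) 0 ξ * En N P ξ) +
            (cone θ).indicator (fun ξ => ENNReal.ofReal (gw b d τ ξ * En N P ξ)) ξ) := by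
          apply lintegral_mono
          intro ξ
          by_cases h : ξ ∈ cone θ
          · simp only [Set.indicator_of_mem h]; exact le_add_self
          · simp only [Set.indicator_of_notMem h, add_zero]
            exact ENNReal.ofReal_le_ofReal (mul_le_mul_of_nonneg_right
              (gw_out b d θ τ hb hd (abs_le.2 hτ) ξ h) (En_nonneg _ _ _))
      _ = _ := by
          rw [lintegral_add_left (mgE _ _ _), lintegral_indicator (cone_meas θ)]
      _ ≤ _ := by gcongr
  -- integrate over the slope
  have step2 : ENNReal.ofReal lo * ENNReal.ofReal θ ≤ ENNReal.ofReal low * ENNReal.ofReal θ +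
      ∫⁻ τ in Icc (-(θ / 2)) (θ / 2), ∫⁻ ξ in cone θ, ENNReal.ofReal (gw b d τ ξ * En N P ξ) := by
    have h := setLIntegral_mono' (μ := volume) (measurableSet_Icc) step1
    rw [lintegral_add_left measurable_const, setLIntegral_const, setLIntegral_const, Real.volume_Icc,
      show θ / 2 - -(θ / 2) = θ by ring] at h
    exact h
  have Fm : Measurable (fun ξ : ℝ × ℝ => Real.exp (-b * ξ.1 ^ 2) * En N P ξ) :=
    Measurable.mul (by fun_prop) (En_meas N P)
  have step3 : ∫⁻ τ in Icc (-(θ / 2)) (θ / 2), ∫⁻ ξ in cone θ, ENNReal.ofReal (gw b d τ ξ * En N P ξ) ≤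
      ∫⁻ s : ℝ, ∫⁻ y : ℝ, (cone θ).indicator (fun ξ : ℝ × ℝ => ENNReal.ofReal (Real.exp (-b * ξ.1 ^ 2) * En N P ξ)
        * ENNReal.ofReal (√(π / d) / |ξ.1|)) (s, y) := by
    rw [lintegral_lintegral_swap]
    · calc _ ≤ ∫⁻ ξ in cone θ, ENNReal.ofReal (Real.exp (-b * ξ.1 ^ 2) * En N P ξ)
              * ENNReal.ofReal (√(π / d) / |ξ.1|) := by
            apply lintegral_mono_ae
            apply ae_restrict_of_ae
            have hne : ∀ᵐ ξ : ℝ × ℝ, ξ.1 ≠ 0 := by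
              rw [Measure.volume_eq_prod]
              exact Measure.quasiMeasurePreserving_fst.ae (Measure.ae_ne volume (0:ℝ))
            filter_upwards [hne] with ξ hξ
            rw [← tau_int d ξ.1 ξ.2 hd hξ]
            have hm1 : Measurable (fun τ : ℝ => ENNReal.ofReal (Real.exp (-d * (ξ.2 - τ * ξ.1) ^ 2))) := by
              fun_prop
            rw [← lintegral_const_mul _ hm1]
            refine (setLIntegral_le_lintegral _ _).trans (le_of_eq ?_)
            congr 1; ext τ
            rw [← ENNReal.ofReal_mul (mul_nonneg (Real.exp_pos _).le (En_nonneg _ _ _))]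
            congr 1; unfold gw; ring
        _ = _ := (lintegral_indicator (cone_meas θ) _).symm
        _ ≤ _ := by rw [Measure.volume_eq_prod]; exact lintegral_prod_le _
    · apply Measurable.aemeasurable
      have h1 : Measurable (fun p : ℝ × (ℝ × ℝ) => gw b d p.1 p.2) := by
        unfold gw; fun_prop
      exact (h1.mul ((En_meas N P).comp measurable_snd)).ennreal_ofReal
  have step4 : ∫⁻ s : ℝ, ∫⁻ y : ℝ, (cone θ).indicator (fun ξ : ℝ × ℝ => ENNReal.ofReal (Real.exp (-b * ξ.1 ^ 2) * En N P ξ)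
        * ENNReal.ofReal (√(π / d) / |ξ.1|)) (s, y) ≤
      ∫⁻ s : ℝ, ∫⁻ κ in Icc (-θ) θ, ENNReal.ofReal (√(π / d)) *
        ENNReal.ofReal (Real.exp (-b * s ^ 2) * En N P (s, s * κ)) := by
    apply lintegral_mono_ae
    filter_upwards [Measure.ae_ne volume (0:ℝ)] with s hs
    have hs' : 0 < |s| := abs_pos.2 hs
    have hgm : Measurable (fun y : ℝ => (cone θ).indicator (fun ξ : ℝ × ℝ =>
        ENNReal.ofReal (Real.exp (-b * ξ.1 ^ 2) * En N P ξ) * ENNReal.ofReal (√(π / d) / |ξ.1|)) (s, y)) := by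
      have : Measurable ((cone θ).indicator (fun ξ : ℝ × ℝ =>
        ENNReal.ofReal (Real.exp (-b * ξ.1 ^ 2) * En N P ξ) * ENNReal.ofReal (√(π / d) / |ξ.1|))) :=
        (Fm.ennreal_ofReal.mul (by fun_prop)).indicator (cone_meas θ)
      exact this.comp measurable_prodMk_left
    have hgm2 : Measurable (fun κ : ℝ => (cone θ).indicator (fun ξ : ℝ × ℝ =>
        ENNReal.ofReal (Real.exp (-b * ξ.1 ^ 2) * En N P ξ) * ENNReal.ofReal (√(π / d) / |ξ.1|)) (s, s * κ)) :=
      hgm.comp (measurable_const_mul s)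
    rw [lint_scale s hs _ hgm, ← lintegral_const_mul _ hgm2,
      ← lintegral_indicator measurableSet_Icc]
    apply lintegral_mono
    intro κ
    have hiff : (s, s * κ) ∈ cone θ ↔ κ ∈ Icc (-θ) θ := by
      simp only [cone, mem_ofPred_eq, abs_mul, mem_Icc, ← abs_le]
      rw [mul_comm θ]
      exact mul_le_mul_iff_right₀ hs'
    by_cases hk : κ ∈ Icc (-θ) θ
    · apply le_of_eq
      beta_reduce
      rw [Set.indicator_of_mem hk, Set.indicator_of_mem (hiff.2 hk)]
      dsimp only
      rw [mul_comm (ENNReal.ofReal (Real.exp _ * _)), ← mul_assoc, ← ENNReal.ofReal_mul hs'.le]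
      congr 2; field_simp
    · beta_reduce
      rw [Set.indicator_of_notMem hk, Set.indicator_of_notMem (fun h => hk (hiff.1 h)), mul_zero]
  have step5 : ∫⁻ s : ℝ, ∫⁻ κ in Icc (-θ) θ, ENNReal.ofReal (√(π / d)) *
        ENNReal.ofReal (Real.exp (-b * s ^ 2) * En N P (s, s * κ)) ≤
      ENNReal.ofReal (√(π / d)) * ENNReal.ofReal ((1 / b) * (6 * π * Δ ^ 2)) * ENNReal.ofReal (2 * θ) := by
    have hm2 : Measurable (fun p : ℝ × ℝ => ENNReal.ofReal (Real.exp (-b * p.1 ^ 2) * En N P (p.1, p.1 * p.2))) := by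
      have : Measurable (fun p : ℝ × ℝ => En N P (p.1, p.1 * p.2)) := (En_meas N P).comp (by fun_prop)
      exact (Measurable.mul (by fun_prop) this).ennreal_ofReal
    rw [lintegral_lintegral_swap]
    · calc _ ≤ ∫⁻ κ in Icc (-θ) θ, ENNReal.ofReal (√(π / d)) * ENNReal.ofReal ((1 / b) * (6 * π * Δ ^ 2)) := by
            apply setLIntegral_mono' measurableSet_Icc
            intro κ hκ
            have hm3 : Measurable (fun s : ℝ => ENNReal.ofReal (Real.exp (-b * s ^ 2) * En N P (s, s * κ))) :=
              hm2.comp measurable_prodMk_right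
            rw [lintegral_const_mul _ hm3]
            gcongr
            exact cone_l N P hP hPs θ Δ hθ1 hΔ κ (abs_le.2 hκ) b hb
        _ = _ := by
            rw [setLIntegral_const, Real.volume_Icc, show θ - -θ = 2 * θ by ring]
    · exact (hm2.const_mul _).aemeasurable
  have fin := step2.trans (add_le_add_right (step3.trans (step4.trans step5)) _)
  have c0 : 0 ≤ (1 / b) * (6 * π * Δ ^ 2) := by positivity
  rw [← ENNReal.ofReal_mul' hθ.le, ← ENNReal.ofReal_mul' hθ.le, ← ENNReal.ofReal_mul (by positivity),
    ← ENNReal.ofReal_mul (by positivity), ← ENNReal.ofReal_add (by positivity) (by positivity),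
    ENNReal.ofReal_le_ofReal_iff (by positivity)] at fin
  have : lo * θ ≤ (low + 2 * √(π / d) * ((1 / b) * (6 * π * Δ ^ 2))) * θ := by linarith
  exact le_of_mul_le_mul_right this hθ

lemma final_ineq (N : ℕ) (hN : 1 ≤ N) (P : Finset (ℝ × ℝ)) (hP : P.card = N) (hPs : ↑P ⊆ unitSq) (θ Δ : ℝ)
    (hθ : 0 < θ) (hθ1 : θ ≤ 1)
    (hΔ : ∀ R, IsRectIn (Icc (-θ) θ) R → localDisc N P R ≤ Δ) (hΔ0 : 0 ≤ Δ) :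
    1 / 1000 * θ * (N : ℝ) ^ ((1:ℝ) / 5) ≤ Δ := by
  set y := (N : ℝ) ^ ((1:ℝ) / 5) with hy
  have hN0 : (0:ℝ) < N := by exact_mod_cast hN
  have hy0 : 0 < y := Real.rpow_pos_of_pos hN0 _
  have hy5 : y ^ 5 = N := by
    rw [hy, ← Real.rpow_natCast, ← Real.rpow_mul hN0.le]; norm_num
  have hpi := Real.pi_pos
  set d := 1 / y ^ 4 with hd
  set b := 1 / (256 * π ^ 2 * y ^ 6) with hb
  have hd0 : 0 < d := by positivity
  have hb0 : 0 < b := by positivity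
  have h := main_ineq N P hP hPs θ Δ hθ hθ1 hΔ hΔ0 b d hb0 hd0
  have e1 : √(π / b) * √(π / d) = 16 * π ^ 2 * y ^ 5 := by
    rw [← Real.sqrt_mul (by positivity), show π / b * (π / d) = (16 * π ^ 2 * y ^ 5) ^ 2 by
      rw [hb, hd]; field_simp; ring]
    exact Real.sqrt_sq (by positivity)
  have e2 : √(π / (d * θ ^ 2 / 8)) * √(π / (d / 8)) = 8 * π * y ^ 4 / θ := by
    rw [← Real.sqrt_mul (by positivity), show π / (d * θ ^ 2 / 8) * (π / (d / 8)) = (8 * π * y ^ 4 / θ) ^ 2 by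
      rw [hd]; field_simp; try ring]
    exact Real.sqrt_sq (by positivity)
  have e3 : √(π / d) = √π * y ^ 2 := by
    rw [show π / d = π * (y ^ 2) ^ 2 by rw [hd]; field_simp, Real.sqrt_mul hpi.le, Real.sqrt_sq (by positivity)]
  rw [e1, e2, e3, ← hy5, hb] at h
  by_contra! hc
  -- set z = Δ / y
  obtain ⟨z, hz⟩ : ∃ z, Δ = z * y := ⟨Δ / y, by field_simp⟩
  have hz0 : 0 ≤ z := by
    rw [hz] at hΔ0; exact nonneg_of_mul_nonneg_left hΔ0 hy0
  have hz1 : z < 1 / 1000 * θ := by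
    rw [hz] at hc; exact lt_of_mul_lt_mul_right hc hy0.le
  have hs2 : √π ≤ 2 := by
    rw [Real.sqrt_le_left (by norm_num)]; nlinarith [Real.pi_le_four]
  have h2 : 8 * π ^ 2 * y ^ 10 ≤ (16 * π * (z / θ) + 3072 * π ^ 3 * √π * z ^ 2) * y ^ 10 := by
    rw [hz] at h
    have l : y ^ 5 * (16 * π ^ 2 * y ^ 5) - 8 * π ^ 2 * (y ^ 5) ^ 2 = 8 * π ^ 2 * y ^ 10 := by ring
    have r : 8 * π * y ^ 4 / θ * (z * y) * (2 * y ^ 5) +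
        2 * (√π * y ^ 2) * (1 / (1 / (256 * π ^ 2 * y ^ 6)) * (6 * π * (z * y) ^ 2)) =
        (16 * π * (z / θ) + 3072 * π ^ 3 * √π * z ^ 2) * y ^ 10 := by
      field_simp; ring
    rw [l, r] at h; exact h
  have h3 := le_of_mul_le_mul_right h2 (by positivity)
  have h4 : z / θ ≤ 1 / 1000 := by rw [div_le_iff₀ hθ]; exact hz1.le
  have h5 : z ^ 2 ≤ 1 / 1000000 := by
    have : z ≤ 1 / 1000 := by nlinarith
    nlinarith
  have hp4 := Real.pi_le_four
  have hp3 := Real.pi_gt_three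
  have h6 : 16 * π * (z / θ) ≤ 16 * 4 * (1 / 1000) := by gcongr
  have h7 : 3072 * π ^ 3 * √π * z ^ 2 ≤ 3072 * 4 ^ 3 * 2 * (1 / 1000000) := by gcongr
  nlinarith

lemma localDisc_le (N : ℕ) (P : Finset (ℝ × ℝ)) (hP : P.card = N) (R : Set (ℝ × ℝ)) :
    localDisc N P R ≤ N := by
  unfold localDisc
  have h1 : (((P : Set (ℝ × ℝ)) ∩ R).ncard : ℝ) ≤ N := by
    have := Set.ncard_le_ncard (Set.inter_subset_left (s := (P : Set (ℝ × ℝ))) (t := R)) P.finite_toSet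
    rw [Set.ncard_coe_finset, hP] at this
    exact_mod_cast this
  have h2 : (volume (R ∩ unitSq)).toReal ≤ 1 := by
    have := measure_mono (μ := volume) (Set.inter_subset_right (s := R) (t := unitSq))
    rw [unitSq_vol] at this
    exact ENNReal.toReal_le_of_le_ofReal zero_le_one (by simpa using this)
  have h3 : 0 ≤ (volume (R ∩ unitSq)).toReal := ENNReal.toReal_nonneg
  have h4 : (0:ℝ) ≤ (((P : Set (ℝ × ℝ)) ∩ R).ncard : ℝ) := Nat.cast_nonneg _
  have h5 : (0:ℝ) ≤ N := Nat.cast_nonneg _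
  rw [abs_le]
  constructor <;> nlinarith

/-- **Corollary 2.** There is a constant `c' > 0` such that for every `θ ∈ (0, π/4)`
and every `N ≥ 1`, `D(N, R_{[-θ,θ]}) ≥ c' θ N^{1/5}`. -/
theorem directional_discrepancy_lower_bound_all_N :
    ∃ c' > (0:ℝ), ∀ θ : ℝ, θ ∈ Set.Ioo 0 (π/4) → ∀ N : ℕ, 1 ≤ N →
      c' * θ * (N : ℝ) ^ ((1:ℝ)/5) ≤ optDisc N (Set.Icc (-θ) θ) := by
  refine ⟨1 / 1000, by norm_num, ?_⟩
  intro θ hθ N hN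
  have hθ1 : θ ≤ 1 := by have := hθ.2; have := Real.pi_le_four; linarith
  unfold optDisc
  apply le_csInf
  · have hinf : unitSq.Infinite := by
      intro hf
      have := hf.measure_zero (volume : Measure (ℝ × ℝ))
      rw [unitSq_vol] at this
      exact one_ne_zero this
    obtain ⟨P, h1, h2⟩ := hinf.exists_subset_card_eq N
    exact ⟨_, P, h1, h2, rfl⟩
  · rintro D ⟨P, hPs, hP, rfl⟩
    have hbd : BddAbove {d : ℝ | ∃ R : Set (ℝ × ℝ), IsRectIn (Set.Icc (-θ) θ) R ∧ d = localDisc N P R} := by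
      refine ⟨N, ?_⟩
      rintro d ⟨R, _, rfl⟩
      exact localDisc_le N P hP R
    have hΔ : ∀ R, IsRectIn (Set.Icc (-θ) θ) R → localDisc N P R ≤ disc N P (Set.Icc (-θ) θ) :=
      fun R hR => le_csSup hbd ⟨R, hR, rfl⟩
    have hΔ0 : 0 ≤ disc N P (Set.Icc (-θ) θ) := by
      refine le_trans ?_ (hΔ (rot 0 '' (Set.Icc 0 0 ×ˢ Set.Icc 0 0))
        ⟨0, ⟨by linarith [hθ.1], hθ.1.le⟩, 0, 0, 0, 0, le_rfl, le_rfl, rfl⟩)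
      exact abs_nonneg _
    exact final_ineq N hN P hP hPs θ _ hθ.1 hθ1 hΔ hΔ0
end
end

section
/- There exist constants c' > 0 and C > 0 such that for every θ ∈ (0, π/4), every R > 0, and every nonzero ξ ∈ ℝ² with arg(ξ) ∈ (-θ/2, θ/2) and |ξ| ≥ c'/(θR), one has φ_{R,θ}(ξ) ≥ C·R/(θ·|ξ|³). -/
open Real MeasureTheory Set

noncomputable section

/-- Indicator function `1_{r,ν}` of the square `[-r,r]²` rotated counterclockwise by
angle `ν` about the origin. -/
def sqInd (r ν : ℝ) : ℝ × ℝ → ℝ :=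
  Set.indicator (rot ν '' (Set.Icc (-r) r ×ˢ Set.Icc (-r) r)) 1

/-- Fourier transform `1̂_{r,ν}(ξ) = ∫_{ℝ²} 1_{r,ν}(x) e^{-2πi x·ξ} dx`. -/
def ftSq (r ν : ℝ) (ξ : ℝ × ℝ) : ℂ :=
  ∫ x : ℝ × ℝ, (sqInd r ν x : ℂ) *
    Complex.exp (-(2 * (π : ℂ) * Complex.I * ((x.1 * ξ.1 + x.2 * ξ.2 : ℝ) : ℂ)))

/-- Euclidean length `|ξ|` of a plane vector. -/
def nrm (ξ : ℝ × ℝ) : ℝ := Real.sqrt (ξ.1 ^ 2 + ξ.2 ^ 2)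

/-- Averaged squared Fourier decay
`φ_{R,θ}(ξ) = (1/(Rθ)) ∫_{R/2}^R ∫_{-θ}^{θ} |1̂_{r,ν}(ξ)|² dν dr`. -/
def phi (R θ : ℝ) (ξ : ℝ × ℝ) : ℝ :=
  (1 / (R * θ)) * ∫ r in (R/2)..R, ∫ ν in (-θ)..θ, ‖ftSq r ν ξ‖ ^ 2

/-- `ξ` has argument `α`, i.e. `ξ = |ξ|(cos α, sin α)`. -/
def hasArg (ξ : ℝ × ℝ) (α : ℝ) : Prop :=
  ξ = (nrm ξ * Real.cos α, nrm ξ * Real.sin α)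

lemma oneD (r a : ℝ) (hr : 0 ≤ r) :
    ∫ t in Set.Icc (-r) r, Complex.exp (-(2 * (π : ℂ) * Complex.I * ((t * a : ℝ) : ℂ)))
      = ((2 * r * sinc (2 * π * r * a) : ℝ) : ℂ) := by
  rw [integral_Icc_eq_integral_Ioc, ← intervalIntegral.integral_of_le (by linarith)]
  by_cases ha : a = 0
  · subst ha
    simp
    ring
  · have hc : (2 * π * a) ≠ 0 := by positivity
    have h1 : ∀ t : ℝ, Complex.exp (-(2 * (π : ℂ) * Complex.I * ((t * a : ℝ) : ℂ)))
        = (fun u : ℝ => Complex.exp (u * Complex.I)) (t * (-(2 * π * a))) := by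
      intro t
      simp only
      congr 1
      push_cast
      ring
    simp_rw [h1]
    rw [intervalIntegral.integral_comp_mul_right (fun u : ℝ => Complex.exp (u * Complex.I)) (neg_ne_zero.2 hc)]
    have h2 : -r * -(2 * π * a) = -(-(2 * π * r * a)) := by ring
    have h3 : r * -(2 * π * a) = -(2 * π * r * a) := by ring
    rw [h2, h3, integral_exp_mul_I_eq_sinc, sinc_neg, Complex.real_smul]
    push_cast
    have : (a : ℂ) ≠ 0 := by exact_mod_cast ha
    have : (π : ℂ) ≠ 0 := by exact_mod_cast pi_ne_zero
    field_simp

def rotL (ν : ℝ) : ℝ × ℝ →L[ℝ] ℝ × ℝ :=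
  LinearMap.toContinuousLinearMap (Matrix.toLin (Module.Basis.finTwoProd ℝ)
    (Module.Basis.finTwoProd ℝ) !![Real.cos ν, -Real.sin ν; Real.sin ν, Real.cos ν])

lemma rotL_apply (ν : ℝ) (p : ℝ × ℝ) : rotL ν p = rot ν p := by
  simp [rotL, rot, Matrix.toLin_finTwoProd_apply]
  constructor <;> ring

lemma rotL_det (ν : ℝ) : (rotL ν).det = 1 := by
  unfold rotL
  simp only [LinearMap.det_toContinuousLinearMap, LinearMap.det_toLin, Matrix.det_fin_two_of]
  nlinarith [Real.sin_sq_add_cos_sq ν]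

lemma rot_inj (ν : ℝ) : Function.Injective (rot ν) := by
  rintro ⟨x, y⟩ ⟨z, w⟩ h
  simp only [rot, Prod.mk.injEq] at h
  obtain ⟨h1, h2⟩ := h
  have e := Real.sin_sq_add_cos_sq ν
  ext
  · linear_combination Real.cos ν * h1 + Real.sin ν * h2 + (z - x) * e
  · linear_combination Real.cos ν * h2 - Real.sin ν * h1 + (w - y) * e

lemma ftSq_eq (r ν ρ α : ℝ) (hr : 0 ≤ r) :
    ftSq r ν (ρ * Real.cos α, ρ * Real.sin α) =
      ((2 * r * sinc (2 * π * r * (ρ * Real.cos (α - ν))) *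
        (2 * r * sinc (2 * π * r * (ρ * Real.sin (α - ν)))) : ℝ) : ℂ) := by
  have hs : MeasurableSet (Set.Icc (-r) r ×ˢ Set.Icc (-r) r) :=
    measurableSet_Icc.prod measurableSet_Icc
  have hd : ∀ x ∈ (Set.Icc (-r) r ×ˢ Set.Icc (-r) r),
      HasFDerivWithinAt (rot ν) (rotL ν) (Set.Icc (-r) r ×ˢ Set.Icc (-r) r) x := by
    intro x _
    have : rot ν = rotL ν := by
      funext p
      rw [rotL_apply]
    rw [this]
    exact (rotL ν).hasFDerivAt.hasFDerivWithinAt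
  have him : MeasurableSet (rot ν '' (Set.Icc (-r) r ×ˢ Set.Icc (-r) r)) :=
    measurable_image_of_fderivWithin hs hd (rot_inj ν).injOn
  unfold ftSq
  have h1 : ∀ x : ℝ × ℝ, (sqInd r ν x : ℂ) *
    Complex.exp (-(2 * (π : ℂ) * Complex.I *
      ((x.1 * (ρ * Real.cos α, ρ * Real.sin α).1
        + x.2 * (ρ * Real.cos α, ρ * Real.sin α).2 : ℝ) : ℂ))) =
      Set.indicator (rot ν '' (Set.Icc (-r) r ×ˢ Set.Icc (-r) r)) (fun x : ℝ × ℝ =>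
        Complex.exp (-(2 * (π : ℂ) * Complex.I *
      ((x.1 * (ρ * Real.cos α) + x.2 * (ρ * Real.sin α) : ℝ) : ℂ)))) x := by
    intro x
    by_cases hx : x ∈ rot ν '' (Set.Icc (-r) r ×ˢ Set.Icc (-r) r)
    · simp only [sqInd, Set.indicator_of_mem hx]
      simp
    · simp only [sqInd, Set.indicator_of_notMem hx]
      simp
  simp_rw [h1]
  rw [integral_indicator him,
    integral_image_eq_integral_abs_det_fderiv_smul volume hs hd (rot_inj ν).injOn]
  have h2 : ∀ x : ℝ × ℝ, |(rotL ν).det| • Complex.exp (-(2 * (π : ℂ) * Complex.I *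
      (((rot ν x).1 * (ρ * Real.cos α) + (rot ν x).2 * (ρ * Real.sin α) : ℝ) : ℂ))) =
      Complex.exp (-(2 * (π : ℂ) * Complex.I * ((x.1 * (ρ * Real.cos (α - ν)) : ℝ) : ℂ))) *
      Complex.exp (-(2 * (π : ℂ) * Complex.I * ((x.2 * (ρ * Real.sin (α - ν)) : ℝ) : ℂ))) := by
    intro x
    rw [rotL_det, abs_one, one_smul, ← Complex.exp_add]
    congr 1
    rw [← neg_add, ← mul_add, ← Complex.ofReal_add]
    congr 3
    simp only [rot, Real.cos_sub, Real.sin_sub]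
    ring
  simp_rw [h2]
  rw [Measure.volume_eq_prod, setIntegral_prod_mul
    (fun t : ℝ => Complex.exp (-(2 * (π : ℂ) * Complex.I * ((t * (ρ * Real.cos (α - ν)) : ℝ) : ℂ))))
    (fun t : ℝ => Complex.exp (-(2 * (π : ℂ) * Complex.I * ((t * (ρ * Real.sin (α - ν)) : ℝ) : ℂ)))),
    oneD _ _ hr, oneD _ _ hr]
  push_cast
  ring

/-- The explicit square modulus. -/
def GG (ρ α r ν : ℝ) : ℝ :=
  (2 * r * sinc (2 * π * r * (ρ * Real.cos (α - ν)))) ^ 2 *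
        (2 * r * sinc (2 * π * r * (ρ * Real.sin (α - ν)))) ^ 2

lemma GG_cont (ρ α : ℝ) : Continuous (Function.uncurry (GG ρ α)) := by
  unfold GG Function.uncurry
  have h1 : Continuous fun p : ℝ × ℝ => sinc (2 * π * p.1 * (ρ * Real.cos (α - p.2))) :=
    continuous_sinc.comp (by fun_prop)
  have h2 : Continuous fun p : ℝ × ℝ => sinc (2 * π * p.1 * (ρ * Real.sin (α - p.2))) :=
    continuous_sinc.comp (by fun_prop)
  fun_prop

lemma GG_nonneg (ρ α r ν : ℝ) : 0 ≤ GG ρ α r ν := by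
  unfold GG
  positivity

lemma sinc_lower (x : ℝ) (hx : |x| ≤ π / 2) : (2 / π) ^ 2 ≤ sinc x ^ 2 := by
  by_cases h : x = 0
  · subst h
    rw [sinc_zero]
    have : 2 / π ≤ 1 := by
      rw [div_le_one pi_pos]
      linarith [pi_gt_three]
    have h0 : 0 ≤ 2 / π := by positivity
    gcongr
  · have h1 := mul_abs_le_abs_sin hx
    have hp : 0 < |x| := abs_pos.2 h
    rw [sinc_of_ne_zero h, ← sq_abs (Real.sin x / x), abs_div]
    have : 2 / π ≤ |Real.sin x| / |x| := by rwa [le_div_iff₀ hp]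
    gcongr

lemma two_r_sinc_sq (r a : ℝ) (ha : a ≠ 0) :
    (2 * r * sinc (2 * π * r * a)) ^ 2 = Real.sin (2 * π * r * a) ^ 2 / (π * a) ^ 2 := by
  by_cases hr : r = 0
  · simp [hr]
  · rw [sinc_of_ne_zero (by positivity)]
    field_simp

lemma sin_sq_int (R a : ℝ) (hR : 0 < R) (ha : 2 / (π * R) ≤ a) :
    R / 8 ≤ ∫ r in (R/2)..R, Real.sin (2 * π * r * a) ^ 2 := by
  have ha0 : 0 < a := lt_of_lt_of_le (by positivity) ha
  have hc : (2 * π * a) ≠ 0 := by positivity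
  have h1 : ∀ r : ℝ, Real.sin (2 * π * r * a) ^ 2
      = (fun u : ℝ => Real.sin u ^ 2) (r * (2 * π * a)) := by
    intro t
    simp only
    congr 2
    ring
  simp_rw [h1]
  rw [intervalIntegral.integral_comp_mul_right (fun u : ℝ => Real.sin u ^ 2) hc, integral_sin_sq, smul_eq_mul]
  set A := R / 2 * (2 * π * a) with hA
  set B := R * (2 * π * a) with hB
  have e1 : -1 ≤ 2 * (Real.sin A * Real.cos A) := by
    nlinarith [Real.sin_sq_add_cos_sq A, sq_nonneg (Real.sin A + Real.cos A)]
  have e2 : 2 * (Real.sin B * Real.cos B) ≤ 1 := by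
    nlinarith [Real.sin_sq_add_cos_sq B, sq_nonneg (Real.sin B - Real.cos B)]
  rw [div_le_iff₀ (by positivity)] at ha
  rw [inv_mul_eq_div, le_div_iff₀ (by positivity)]
  nlinarith

lemma inner_lower (R θ ρ α ν : ℝ) (hθ : 0 < θ) (hθ' : θ < π / 4) (hR : 0 < R) (hρ : 0 < ρ)
    (hρ' : 1 / (θ * R) ≤ ρ) (hν : |α - ν| ≤ 1 / (4 * ρ * R)) :
    R ^ 3 / (2 * π ^ 4 * ρ ^ 2) ≤ ∫ r in (R/2)..R, GG ρ α r ν := by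
  have hpi := pi_pos
  have hpi3 := pi_gt_three
  have hpi4 := pi_lt_four
  have hθρ : 1 ≤ ρ * (θ * R) := by rwa [div_le_iff₀ (by positivity)] at hρ'
  have hδ : 1 / (4 * ρ * R) ≤ θ / 4 := by
    rw [div_le_iff₀ (by positivity)]
    nlinarith
  have hβ : |α - ν| ≤ 1 / 4 := by linarith
  have hcos : 1 / 2 ≤ Real.cos (α - ν) := by
    have := one_sub_sq_div_two_le_cos (x := α - ν)
    have h2 : (α - ν) ^ 2 ≤ (1 / 4) ^ 2 := by
      rw [← sq_abs]
      gcongr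
    linarith
  have ha : 2 / (π * R) ≤ ρ * Real.cos (α - ν) := by
    rw [div_le_iff₀ (by positivity)]
    have h1 : 4 ≤ ρ * R * π := by
      have : ρ * R * θ ≤ ρ * R * (π / 4) := by gcongr
      linarith
    have : ρ * R * π * (1 / 2) ≤ ρ * R * π * Real.cos (α - ν) := by gcongr
    linarith
  have ha0 : 0 < ρ * Real.cos (α - ν) := lt_of_lt_of_le (by positivity) ha
  have key : ∀ r ∈ Set.Icc (R/2) R,
      4 * R ^ 2 / (π ^ 4 * ρ ^ 2) * Real.sin (2 * π * r * (ρ * Real.cos (α - ν))) ^ 2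
        ≤ GG ρ α r ν := by
    intro r hr
    have hr0 : 0 < r := by linarith [hr.1]
    unfold GG
    rw [two_r_sinc_sq _ _ ha0.ne']
    have hb : |2 * π * r * (ρ * Real.sin (α - ν))| ≤ π / 2 := by
      rw [abs_mul (2 * π * r), abs_mul ρ, abs_of_pos (by positivity : 0 < 2 * π * r), abs_of_pos hρ]
      have h1 : |Real.sin (α - ν)| ≤ 1 / (4 * ρ * R) := abs_sin_le_abs.trans hν
      calc 2 * π * r * (ρ * |Real.sin (α - ν)|) ≤ 2 * π * R * (ρ * (1 / (4 * ρ * R))) := by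
            gcongr
            exact hr.2
        _ = π / 2 := by
            field_simp
            norm_num
    have h2 := sinc_lower _ hb
    have h3 : R ^ 2 * (2 / π) ^ 2 ≤ (2 * r * sinc (2 * π * r * (ρ * Real.sin (α - ν)))) ^ 2 := by
      rw [mul_pow]
      have : R ≤ 2 * r := by linarith [hr.1]
      gcongr
    have h4 : Real.sin (2 * π * r * (ρ * Real.cos (α - ν))) ^ 2 / (π * ρ) ^ 2 ≤
        Real.sin (2 * π * r * (ρ * Real.cos (α - ν))) ^ 2 / (π * (ρ * Real.cos (α - ν))) ^ 2 := by
      have : ρ * Real.cos (α - ν) ≤ ρ := by nlinarith [Real.cos_le_one (α - ν)]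
      gcongr
    calc _ = Real.sin (2 * π * r * (ρ * Real.cos (α - ν))) ^ 2 / (π * ρ) ^ 2
          * (R ^ 2 * (2 / π) ^ 2) := by
          field_simp
          norm_num
      _ ≤ _ := by gcongr
  have hc1 : Continuous fun r => GG ρ α r ν :=
    (GG_cont ρ α).comp (by fun_prop : Continuous fun r : ℝ => (r, ν))
  calc _ = 4 * R ^ 2 / (π ^ 4 * ρ ^ 2) * (R / 8) := by
        field_simp
        norm_num
    _ ≤ 4 * R ^ 2 / (π ^ 4 * ρ ^ 2) *
        ∫ r in (R/2)..R, Real.sin (2 * π * r * (ρ * Real.cos (α - ν))) ^ 2 := by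
        gcongr
        exact sin_sq_int R _ hR ha
    _ = ∫ r in (R/2)..R, 4 * R ^ 2 / (π ^ 4 * ρ ^ 2) *
          Real.sin (2 * π * r * (ρ * Real.cos (α - ν))) ^ 2 := by
        rw [intervalIntegral.integral_const_mul]
    _ ≤ _ := by
        apply intervalIntegral.integral_mono_on (by linarith) _ _ key
        · exact Continuous.intervalIntegrable (by fun_prop) _ _
        · exact hc1.intervalIntegrable _ _

/-- **Proposition 3 (i).** There are constants `c', C > 0` such that for every
`θ ∈ (0, π/4)`, `R > 0` and nonzero `ξ` with `arg ξ ∈ (-θ/2, θ/2)` and `|ξ| ≥ c'/(θR)`,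
one has `φ_{R,θ}(ξ) ≥ C·R/(θ|ξ|³)`. -/
theorem phi_lower_bound_sector :
    ∃ c' > (0:ℝ), ∃ C > (0:ℝ), ∀ θ : ℝ, θ ∈ Set.Ioo 0 (π/4) → ∀ R : ℝ, 0 < R →
      ∀ ξ : ℝ × ℝ, ξ ≠ 0 →
      (∃ α ∈ Set.Ioo (-(θ/2)) (θ/2), hasArg ξ α) →
      c' / (θ * R) ≤ nrm ξ →
      C * R / (θ * nrm ξ ^ 3) ≤ phi R θ ξ := by
  refine ⟨1, one_pos, 1 / (4 * π ^ 4), by positivity, ?_⟩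
  rintro θ ⟨hθ, hθ'⟩ R hR ξ hξ ⟨α, ⟨hα1, hα2⟩, harg⟩ hρ'
  set ρ := nrm ξ with hρdef
  have hpi := pi_pos
  have hρ : 0 < ρ := lt_of_lt_of_le (by positivity) hρ'
  have harg' : ξ = (ρ * Real.cos α, ρ * Real.sin α) := harg
  have hphi : phi R θ ξ = (1 / (R * θ)) * ∫ r in (R/2)..R, ∫ ν in (-θ)..θ, GG ρ α r ν := by
    unfold phi
    congr 1
    apply intervalIntegral.integral_congr
    intro r hr
    rw [uIcc_of_le (by linarith)] at hr
    have hr0 : 0 ≤ r := by linarith [hr.1]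
    apply intervalIntegral.integral_congr
    intro ν _
    simp only
    rw [harg', ftSq_eq _ _ _ _ hr0, Complex.norm_real, Real.norm_eq_abs, sq_abs, mul_pow]
    rfl
  have hθρ : 1 ≤ ρ * (θ * R) := by rwa [div_le_iff₀ (by positivity)] at hρ'
  have hδ : 1 / (4 * ρ * R) ≤ θ / 4 := by
    rw [div_le_iff₀ (by positivity)]
    nlinarith
  have hδ0 : 0 < 1 / (4 * ρ * R) := by positivity
  set δ := 1 / (4 * ρ * R) with hδdef
  have hswap : ∫ r in (R/2)..R, ∫ ν in (-θ)..θ, GG ρ α r ν =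
      ∫ ν in (-θ)..θ, ∫ r in (R/2)..R, GG ρ α r ν := by
    apply intervalIntegral_intervalIntegral_swap
    have : IntegrableOn (Function.uncurry (GG ρ α)) (Set.uIcc (R/2) R ×ˢ Set.uIcc (-θ) θ) :=
      (GG_cont ρ α).continuousOn.integrableOn_compact (isCompact_uIcc.prod isCompact_uIcc)
    exact this.mono_set (Set.prod_mono Set.uIoc_subset_uIcc Set.uIoc_subset_uIcc)
  have hcont : Continuous fun ν => ∫ r in (R/2)..R, GG ρ α r ν := by
    apply intervalIntegral.continuous_parametric_intervalIntegral_of_continuous'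
    exact (GG_cont ρ α).comp continuous_swap
  have hmain : 2 * δ * (R ^ 3 / (2 * π ^ 4 * ρ ^ 2)) ≤
      ∫ ν in (-θ)..θ, ∫ r in (R/2)..R, GG ρ α r ν := by
    calc 2 * δ * (R ^ 3 / (2 * π ^ 4 * ρ ^ 2))
        = ∫ ν in (α - δ)..(α + δ), R ^ 3 / (2 * π ^ 4 * ρ ^ 2) := by
          rw [intervalIntegral.integral_const, smul_eq_mul]
          ring
      _ ≤ ∫ ν in (α - δ)..(α + δ), ∫ r in (R/2)..R, GG ρ α r ν := by
          apply intervalIntegral.integral_mono_on (by linarith)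
          · exact intervalIntegrable_const
          · exact hcont.intervalIntegrable _ _
          · intro ν hν
            apply inner_lower R θ ρ α ν hθ hθ' hR hρ hρ'
            rw [abs_le]
            constructor <;> linarith [hν.1, hν.2]
      _ ≤ _ := by
          apply intervalIntegral.integral_mono_interval (by linarith) (by linarith) (by linarith)
          · refine Filter.Eventually.of_forall fun ν => ?_
            exact intervalIntegral.integral_nonneg (by linarith) fun r _ => GG_nonneg _ _ _ _
          · exact hcont.intervalIntegrable _ _
  rw [hphi, hswap]
  calc _ = (1 / (R * θ)) * (2 * δ * (R ^ 3 / (2 * π ^ 4 * ρ ^ 2))) := by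
        rw [hδdef]
        field_simp
    _ ≤ _ := by gcongr
end
end
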